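/- Let p, q, p', q' be positive integers with p ≥ q ≥ 2, q ≤ q', p ≤ p' and q' < min{2q−1, p}. Let P = (P',P'') be a tuple representing a rational proper map of degree d from the generalized ball D_{q,p} to D_{q',p'}, and assume it is fibral-image-preserving: for every Z ∈ D^I_{q,p} there exists W ∈ D^I_{q',p'} such that P'(A,AZ)·W = P''(A,AZ) for every row vector A ∈ M(1,q;ℂ) with P(A,AZ) ≠ 0. Then d = 1 (the map is linear), and there exist a generalized unitary matrix Q of signature (q,p), a generalized unitary matrix M of signature (q',p') and a scalar c ∈ ℂ∖{0} such that P(z·Q) = c·ι(z)·M for every row vector z ∈ ℂ^{q+p}, where ι(z₁,…,z_q,w₁,…,w_p) := (z₁,…,z_q,0,…,0,w₁,…,w_p,0,…,0) ∈ ℂ^{q'+p'} pads with q'−q zeros after the first q entries and p'−p zeros at the end. -/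

import Mathlib

open Matrix
open scoped ComplexOrder

/-- The type-I irreducible bounded symmetric domain `D^I_{m,n}`,
realized as the set of complex `m × n` matrices `Z` with `I - Zᴴ Z` positive definite. -/
def typeIDomain (m n : ℕ) : Set (Matrix (Fin m) (Fin n) ℂ) :=
  {Z | (1 - Zᴴ * Z).PosDef}

/-- `(P1, P2)` represents a rational proper map of degree `d` from the generalized ball
`D_{r,s}` to `D_{r',s'}`: the components are homogeneous polynomials of common degree
`d ≥ 1`, not all zero, with no common non-constant factor, sending (where defined) the
cone over `D_{r,s}` into the cone over `D_{r',s'}` and the boundary cone into the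
boundary cone. -/
def IsRatProperRep (r s r' s' d : ℕ)
    (P1 : Fin r' → MvPolynomial (Fin (r + s)) ℂ)
    (P2 : Fin s' → MvPolynomial (Fin (r + s)) ℂ) : Prop :=
  1 ≤ d ∧
  (∀ i, (P1 i).IsHomogeneous d) ∧
  (∀ j, (P2 j).IsHomogeneous d) ∧
  ¬ ((∀ i, P1 i = 0) ∧ (∀ j, P2 j = 0)) ∧
  (∀ g : MvPolynomial (Fin (r + s)) ℂ,
    (∀ i, g ∣ P1 i) → (∀ j, g ∣ P2 j) → g.totalDegree = 0) ∧
  (∀ (A : Fin r → ℂ) (B : Fin s → ℂ),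
    ∑ j, ‖B j‖ ^ 2 < ∑ i, ‖A i‖ ^ 2 →
    ¬ ((∀ i, MvPolynomial.eval (Fin.append A B) (P1 i) = 0) ∧
       (∀ j, MvPolynomial.eval (Fin.append A B) (P2 j) = 0)) →
    ∑ j, ‖MvPolynomial.eval (Fin.append A B) (P2 j)‖ ^ 2
      < ∑ i, ‖MvPolynomial.eval (Fin.append A B) (P1 i)‖ ^ 2) ∧
  (∀ (A : Fin r → ℂ) (B : Fin s → ℂ), ¬ (A = 0 ∧ B = 0) →
    ∑ i, ‖A i‖ ^ 2 = ∑ j, ‖B j‖ ^ 2 →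
    ¬ ((∀ i, MvPolynomial.eval (Fin.append A B) (P1 i) = 0) ∧
       (∀ j, MvPolynomial.eval (Fin.append A B) (P2 j) = 0)) →
    ∑ i, ‖MvPolynomial.eval (Fin.append A B) (P1 i)‖ ^ 2
      = ∑ j, ‖MvPolynomial.eval (Fin.append A B) (P2 j)‖ ^ 2)

/-- The matrix `I_{m,n} = diag(I_m, -I_n)`. -/
def sigMatrix (m n : ℕ) : Matrix (Fin (m + n)) (Fin (m + n)) ℂ :=
  Matrix.diagonal fun i => if (i : ℕ) < m then 1 else -1

/-- The padding map `ι : ℂ^{r+s} → ℂ^{r'+s'}` sending `(z₁,…,z_r,w₁,…,w_s)` to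
`(z₁,…,z_r,0,…,0,w₁,…,w_s,0,…,0)` with `r'-r` zeros after the first `r` entries and
`s'-s` zeros at the end. -/
def padSig (r s r' s' : ℕ) (z : Fin (r + s) → ℂ) : Fin (r' + s') → ℂ :=
  fun i =>
    if h : (i : ℕ) < r then z ⟨(i : ℕ), by omega⟩
    else if h2 : r' ≤ (i : ℕ) ∧ (i : ℕ) < r' + s then z ⟨(i : ℕ) - r' + r, by omega⟩
    else 0


/-! ## Real-polynomial functions along lines -/

def RLP {V : Type*} [AddCommGroup V] [Module ℂ V] (F : V → ℂ) : Prop :=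
  ∀ a b : V, ∃ p : Polynomial ℂ, ∀ t : ℝ, F (a + (t : ℂ) • b) = p.eval (t : ℂ)

section RLPsec
variable {V V' : Type*} [AddCommGroup V] [Module ℂ V] [AddCommGroup V'] [Module ℂ V']

theorem RLP.const (c : ℂ) : RLP (fun _ : V => c) :=
  fun _ _ => ⟨Polynomial.C c, by simp⟩

theorem RLP.add {F G : V → ℂ} (hF : RLP F) (hG : RLP G) : RLP (fun v => F v + G v) := by
  intro a b
  obtain ⟨p, hp⟩ := hF a b
  obtain ⟨r, hr⟩ := hG a b
  exact ⟨p + r, fun t => by rw [Polynomial.eval_add, ← hp, ← hr]⟩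

theorem RLP.mul {F G : V → ℂ} (hF : RLP F) (hG : RLP G) : RLP (fun v => F v * G v) := by
  intro a b
  obtain ⟨p, hp⟩ := hF a b
  obtain ⟨r, hr⟩ := hG a b
  exact ⟨p * r, fun t => by rw [Polynomial.eval_mul, ← hp, ← hr]⟩

theorem RLP.neg {F : V → ℂ} (hF : RLP F) : RLP (fun v => - F v) := by
  intro a b
  obtain ⟨p, hp⟩ := hF a b
  exact ⟨-p, fun t => by rw [Polynomial.eval_neg, ← hp]⟩

theorem RLP.sub {F G : V → ℂ} (hF : RLP F) (hG : RLP G) : RLP (fun v => F v - G v) := by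
  simpa [sub_eq_add_neg] using hF.add hG.neg

theorem RLP.conj {F : V → ℂ} (hF : RLP F) : RLP (fun v => star (F v)) := by
  intro a b
  obtain ⟨p, hp⟩ := hF a b
  refine ⟨p.map (starRingEnd ℂ), fun t => ?_⟩
  have h := Polynomial.eval_map_apply (f := starRingEnd ℂ) (p := p) (t : ℂ)
  rw [Complex.conj_ofReal] at h
  rw [h, ← hp, starRingEnd_apply]

theorem RLP.sum {ι : Type*} (s : Finset ι) {F : ι → V → ℂ} (hF : ∀ i ∈ s, RLP (F i)) :
    RLP (fun v => ∑ i ∈ s, F i v) := by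
  classical
  induction s using Finset.induction_on with
  | empty => simpa using RLP.const (V := V) 0
  | insert a s ha ih =>
    simp only [Finset.sum_insert ha]
    exact (hF a (by simp)).add (ih fun i hi => hF i (by simp [hi]))

theorem RLP.prod {ι : Type*} (s : Finset ι) {F : ι → V → ℂ} (hF : ∀ i ∈ s, RLP (F i)) :
    RLP (fun v => ∏ i ∈ s, F i v) := by
  classical
  induction s using Finset.induction_on with
  | empty => simpa using RLP.const (V := V) 1
  | insert a s ha ih =>
    simp only [Finset.prod_insert ha]
    exact (hF a (by simp)).mul (ih fun i hi => hF i (by simp [hi]))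

theorem RLP.comp {F : V' → ℂ} (hF : RLP F) (g : V → V')
    (hg : ∀ a b, ∃ b', ∀ t : ℝ, g (a + (t : ℂ) • b) = g a + (t : ℂ) • b') :
    RLP (fun v => F (g v)) := by
  intro a b
  obtain ⟨b', hb'⟩ := hg a b
  obtain ⟨p, hp⟩ := hF (g a) b'
  exact ⟨p, fun t => by rw [← hp, ← hb']⟩

theorem RLP.lin (g : V →ₗ[ℂ] ℂ) : RLP (fun v => g v) := by
  intro a b
  exact ⟨Polynomial.C (g a) + Polynomial.X * Polynomial.C (g b), fun t => by
    show g (a + (t : ℂ) • b) = _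
    rw [map_add, map_smul]; simp only [Polynomial.eval_add, Polynomial.eval_mul,
      Polynomial.eval_C, Polynomial.eval_X, smul_eq_mul]⟩

theorem RLP.coord {n : ℕ} (i : Fin n) : RLP (fun v : Fin n → ℂ => v i) :=
  RLP.lin (LinearMap.proj (R := ℂ) (φ := fun _ : Fin n => ℂ) i)

theorem RLP.coord2 {m n : ℕ} (k : Fin m) (i : Fin n) :
    RLP (fun v : Fin m → Fin n → ℂ => v k i) :=
  RLP.lin ((LinearMap.proj (R := ℂ) (φ := fun _ : Fin n => ℂ) i).comp
    (LinearMap.proj (R := ℂ) (φ := fun _ : Fin m => Fin n → ℂ) k))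

theorem RLP.eval {σ : Type*} {g : V → σ → ℂ} (hg : ∀ i, RLP (fun v => g v i))
    (f : MvPolynomial σ ℂ) : RLP (fun v => MvPolynomial.eval (g v) f) := by
  induction f using MvPolynomial.induction_on with
  | C a => simpa using RLP.const (V := V) a
  | add p r hp hr => simpa using hp.add hr
  | mul_X p i hp => simpa using hp.mul (hg i)

theorem RLP.det {r : ℕ} {M : V → Matrix (Fin r) (Fin r) ℂ}
    (hM : ∀ i j, RLP (fun v => M v i j)) : RLP (fun v => (M v).det) := by
  simp only [Matrix.det_apply']
  exact RLP.sum _ fun σ _ => (RLP.const _).mul (RLP.prod _ fun i _ => hM _ _)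

theorem RLP.zero_of_infinite {F : V → ℂ} (hF : RLP F) (a b : V)
    (h : {t : ℝ | F (a + (t : ℂ) • b) = 0}.Infinite) (t : ℝ) : F (a + (t : ℂ) • b) = 0 := by
  obtain ⟨p, hp⟩ := hF a b
  have hp0 : p = 0 := by
    apply Polynomial.eq_zero_of_infinite_isRoot
    refine (h.image (f := fun t : ℝ => (t : ℂ)) (fun x _ y _ hxy => by simpa using hxy)).mono ?_
    rintro _ ⟨t, ht, rfl⟩
    simp only [Set.mem_ofPred_eq] at ht ⊢
    rw [Polynomial.IsRoot, ← hp, ht]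
  rw [hp, hp0]; simp

/-- if `F` is nonzero at `a + b`, then it is nonzero at `a + t b` outside a finite set -/
theorem RLP.finite_zero {F : V → ℂ} (hF : RLP F) (a b : V) (s : ℝ)
    (h : F (a + (s : ℂ) • b) ≠ 0) : {t : ℝ | F (a + (t : ℂ) • b) = 0}.Finite := by
  by_contra hc
  exact h (hF.zero_of_infinite a b hc s)

theorem RLP.dense [TopologicalSpace V] [ContinuousAdd V] [ContinuousSMul ℂ V]
    {F : V → ℂ} (hF : RLP F) {v0 : V} (h0 : F v0 ≠ 0) {U : Set V} (hU : IsOpen U) {u : V}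
    (hu : u ∈ U) : ∃ v ∈ U, F v ≠ 0 := by
  by_contra! hc
  apply h0
  have := hF.zero_of_infinite u (v0 - u) ?_ 1
  · simpa using this
  have hcont : Continuous (fun t : ℝ => u + (t : ℂ) • (v0 - u)) := by fun_prop
  have hop : IsOpen ((fun t : ℝ => u + (t : ℂ) • (v0 - u)) ⁻¹' U) := hU.preimage hcont
  have h0mem : (0 : ℝ) ∈ ((fun t : ℝ => u + (t : ℂ) • (v0 - u)) ⁻¹' U) := by simpa using hu
  have hinf := infinite_of_mem_nhds (0 : ℝ) (hop.mem_nhds h0mem)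
  exact hinf.mono fun t ht => hc _ ht

theorem RLP.mul_ne {F G : V → ℂ} (hF : RLP F) (hG : RLP G) {a b : V} (ha : F a ≠ 0)
    (hb : G b ≠ 0) : ∃ v, F v * G v ≠ 0 := by
  have h1 := hF.finite_zero a (b - a) 0 (by simpa using ha)
  have h2 := hG.finite_zero a (b - a) 1 (by simpa using hb)
  obtain ⟨t, ht⟩ := (h1.union h2).infinite_compl.nonempty
  simp only [Set.mem_compl_iff, Set.mem_union, Set.mem_ofPred_eq, not_or] at ht
  exact ⟨_, mul_ne_zero ht.1 ht.2⟩

theorem RLP.semicont {r N : ℕ} {x : Fin r → V → Fin N → ℂ}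
    (hx : ∀ i j, RLP (fun v => x i v j)) (v0 : V)
    (h0 : LinearIndependent ℂ (fun i => x i v0)) :
    ∃ D : V → ℂ, RLP D ∧ D v0 ≠ 0 ∧ ∀ v, D v ≠ 0 → LinearIndependent ℂ (fun i => x i v) := by
  have hinj : LinearMap.ker (Fintype.linearCombination ℂ (fun i => x i v0)) = ⊥ := by
    rw [LinearMap.ker_eq_bot]
    exact linearIndependent_iff_injective_fintypeLinearCombination.1 h0
  obtain ⟨g, hg⟩ := LinearMap.exists_leftInverse_of_injective _ hinj
  have hg1 : ∀ i, g (x i v0) = Pi.single i 1 := by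
    intro i
    have := LinearMap.congr_fun hg (Pi.single i 1)
    simpa using this
  refine ⟨fun v => (Matrix.of fun i j => g (x i v) j).det, RLP.det fun i j => ?_, ?_, ?_⟩
  · have : ∀ v, g (x i v) j = ∑ k, x i v k * g (Pi.single k 1) j := by
      intro v
      conv_lhs => rw [pi_eq_sum_univ' (x i v)]
      simp [Finset.sum_apply]
    simp only [Matrix.of_apply, this]
    exact RLP.sum _ fun k _ => (hx i k).mul (RLP.const _)
  · have : (Matrix.of fun i j => g (x i v0) j) = 1 := by
      ext i j
      simp [hg1, Matrix.one_apply, Pi.single_apply, eq_comm]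
    simp [this]
  · intro v hv
    have := Matrix.linearIndependent_rows_of_det_ne_zero hv
    exact LinearIndependent.of_comp g this

end RLPsec

/-! ## Indefinite Hermitian forms -/

def hf {n : ℕ} (ε : Fin n → ℂ) (z w : Fin n → ℂ) : ℂ := ∑ i, ε i * (z i * star (w i))

noncomputable def ev {n N : ℕ} (P : Fin N → MvPolynomial (Fin n) ℂ) (z : Fin n → ℂ) : Fin N → ℂ :=
  fun i => MvPolynomial.eval z (P i)

def IsSign {n : ℕ} (ε : Fin n → ℂ) : Prop := ∀ i, ε i = 1 ∨ ε i = -1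

theorem IsSign.star {n : ℕ} {ε : Fin n → ℂ} (h : IsSign ε) (i : Fin n) : star (ε i) = ε i := by
  rcases h i with h | h <;> simp [h]

theorem IsSign.mul_self {n : ℕ} {ε : Fin n → ℂ} (h : IsSign ε) (i : Fin n) : ε i * ε i = 1 := by
  rcases h i with h | h <;> simp [h]

section hfsec
variable {n : ℕ} (ε : Fin n → ℂ)

theorem hf_add_left (x y w : Fin n → ℂ) : hf ε (x + y) w = hf ε x w + hf ε y w := by
  simp only [hf, ← Finset.sum_add_distrib, Pi.add_apply]
  exact Finset.sum_congr rfl fun i _ => by ring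

theorem hf_smul_left (c : ℂ) (x w : Fin n → ℂ) : hf ε (c • x) w = c * hf ε x w := by
  simp only [hf, Finset.mul_sum, Pi.smul_apply, smul_eq_mul]
  exact Finset.sum_congr rfl fun i _ => by ring

theorem hf_add_right (x y w : Fin n → ℂ) : hf ε w (x + y) = hf ε w x + hf ε w y := by
  simp only [hf, ← Finset.sum_add_distrib, Pi.add_apply, star_add]
  exact Finset.sum_congr rfl fun i _ => by ring

theorem hf_smul_right (c : ℂ) (x w : Fin n → ℂ) : hf ε w (c • x) = star c * hf ε w x := by
  simp only [hf, Finset.mul_sum, Pi.smul_apply, smul_eq_mul, star_mul]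
  exact Finset.sum_congr rfl fun i _ => by ring

theorem hf_conj (hε : IsSign ε) (x y : Fin n → ℂ) : star (hf ε x y) = hf ε y x := by
  simp only [hf, star_sum, star_mul, star_star, hε.star]
  exact Finset.sum_congr rfl fun i _ => by ring

/-- the form as a linear functional in the first argument -/
def hfl (w : Fin n → ℂ) : (Fin n → ℂ) →ₗ[ℂ] ℂ where
  toFun z := hf ε z w
  map_add' x y := hf_add_left ε x y w
  map_smul' c x := hf_smul_left ε c x w

@[simp] theorem hfl_apply (w z : Fin n → ℂ) : hfl ε w z = hf ε z w := rfl

theorem hf_zero_left (w : Fin n → ℂ) : hf ε 0 w = 0 := (hfl ε w).map_zero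
theorem hf_zero_right (w : Fin n → ℂ) : hf ε w 0 = 0 := by simp [hf]
theorem hf_sub_left (x y w : Fin n → ℂ) : hf ε (x - y) w = hf ε x w - hf ε y w :=
  (hfl ε w).map_sub x y
theorem hf_sub_right (x y w : Fin n → ℂ) : hf ε w (x - y) = hf ε w x - hf ε w y := by
  rw [sub_eq_add_neg, hf_add_right, ← neg_one_smul ℂ y, hf_smul_right]; simp [sub_eq_add_neg]

theorem hf_sum_left {ι : Type*} (s : Finset ι) (x : ι → Fin n → ℂ) (w : Fin n → ℂ) :
    hf ε (∑ i ∈ s, x i) w = ∑ i ∈ s, hf ε (x i) w := by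
  exact map_sum (hfl ε w) x s

theorem hf_comm_zero (hε : IsSign ε) {x y : Fin n → ℂ} (h : hf ε x y = 0) : hf ε y x = 0 := by
  rw [← hf_conj ε hε, h, star_zero]

theorem RLP.hf {V : Type*} [AddCommGroup V] [Module ℂ V] {f g : V → Fin n → ℂ}
    (h1 : ∀ i, RLP (fun v => f v i)) (h2 : ∀ i, RLP (fun v => g v i)) :
    RLP (fun v => hf ε (f v) (g v)) :=
  RLP.sum _ fun i _ => (RLP.const _).mul ((h1 i).mul (h2 i).conj)

theorem RLP.ev {N : ℕ} {V : Type*} [AddCommGroup V] [Module ℂ V] {f : V → Fin n → ℂ}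
    (h1 : ∀ i, RLP (fun v => f v i)) (P : Fin N → MvPolynomial (Fin n) ℂ) (j : Fin N) :
    RLP (fun v => ev P (f v) j) :=
  RLP.eval h1 (P j)

theorem hf_continuous : Continuous (fun z : Fin n → ℂ => (hf ε z z).re) := by
  unfold hf; fun_prop

theorem hf_self_im (hε : IsSign ε) (x : Fin n → ℂ) : hf ε x x = ((hf ε x x).re : ℂ) := by
  have := hf_conj ε hε x x
  exact (Complex.conj_eq_iff_re.1 this).symm

/-- twisting by the signs -/
def tw (w : Fin n → ℂ) : Fin n → ℂ := fun i => ε i * w i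

theorem hf_tw (hε : IsSign ε) (z w : Fin n → ℂ) : hf ε (tw ε z) w = hf (fun _ => 1) z w := by
  simp only [hf, tw]
  refine Finset.sum_congr rfl fun i _ => ?_
  linear_combination (z i * star (w i)) * hε.mul_self i

theorem hf_one_self_ne {w : Fin n → ℂ} (h : w ≠ 0) : hf (fun _ => 1) w w ≠ 0 := by
  intro h0
  apply h
  have h1 : hf (fun _ => 1) w w = ((∑ i, ‖w i‖ ^ 2 : ℝ) : ℂ) := by
    simp only [hf, one_mul]
    push_cast
    exact Finset.sum_congr rfl fun i _ => by rw [← Complex.mul_conj']; rfl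
  rw [h1] at h0
  have h2 := Complex.ofReal_eq_zero.1 h0
  rw [Finset.sum_eq_zero_iff_of_nonneg (fun i _ => by positivity)] at h2
  ext i
  simpa using h2 i (Finset.mem_univ i)

theorem hf_nondeg (hε : IsSign ε) {w : Fin n → ℂ} (h : w ≠ 0) : hf ε (tw ε w) w ≠ 0 := by
  rw [hf_tw ε hε]; exact hf_one_self_ne h

theorem exists_perp (hε : IsSign ε) {m : ℕ} (hm : m + 1 < n) (v0 : Fin m → Fin n → ℂ)
    (w1 : Fin n → ℂ) :
    ∃ u w0, (∀ i, hf ε (v0 i) w0 = 0) ∧ hf ε u w0 = 1 ∧ hf ε u w1 = 0 := by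
  let T : (Fin n → ℂ) →ₗ[ℂ] (Fin (m + 1) → ℂ) :=
    LinearMap.pi (Fin.cons (hfl (fun _ => 1) w1) (fun i => hfl ε (v0 i)))
  have hT : LinearMap.ker T ≠ ⊥ := LinearMap.ker_ne_bot_of_finrank_lt (by simpa using hm)
  obtain ⟨w0, hw0, hne⟩ := (Submodule.ne_bot_iff _).1 hT
  have hw0' : ∀ k, T w0 k = 0 := fun k => by rw [LinearMap.mem_ker.1 hw0]; rfl
  have ha : hf (fun _ => 1) w0 w1 = 0 := by simpa [T] using hw0' 0
  have hb : ∀ i, hf ε w0 (v0 i) = 0 := fun i => by simpa [T] using hw0' i.succ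
  have hk := hf_nondeg ε hε hne
  refine ⟨(hf ε (tw ε w0) w0)⁻¹ • tw ε w0, w0, fun i => hf_comm_zero ε hε (hb i), ?_, ?_⟩
  · rw [hf_smul_left, inv_mul_cancel₀ hk]
  · rw [hf_smul_left, hf_tw ε hε w0 w1, ha, mul_zero]

theorem perp_gen (hε : IsSign ε) {m : ℕ} (hm : m + 1 < n) {F : (Fin m → Fin n → ℂ) → ℂ}
    (hF : RLP F) (v0 : Fin m → Fin n → ℂ) (hv0 : F v0 ≠ 0) (w1 : Fin n → ℂ)
    (hw1 : ∀ i, hf ε (v0 i) w1 = 0) :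
    ∃ G : (Fin n → ℂ) → ℂ, RLP G ∧ (∃ w0, G w0 ≠ 0) ∧
      ∀ w, G w ≠ 0 → ∃ v, F v ≠ 0 ∧ ∀ i, hf ε (v i) w = 0 ∧ hf ε (v i) w1 = 0 := by
  obtain ⟨u, w0, h1, h2, h3⟩ := exists_perp ε hε hm v0 w1
  refine ⟨fun w => F (fun i => hf ε u w • v0 i - hf ε (v0 i) w • u), ?_, ⟨w0, ?_⟩, ?_⟩
  · refine hF.comp _ fun a b => ⟨fun i => hf ε u b • v0 i - hf ε (v0 i) b • u, fun t => ?_⟩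
    ext i j
    simp only [hf_add_right, hf_smul_right, Pi.sub_apply, Pi.add_apply, Pi.smul_apply, smul_eq_mul,
      Complex.star_def, Complex.conj_ofReal]
    ring
  · simpa [h1, h2] using hv0
  · intro w hw
    refine ⟨_, hw, fun i => ⟨?_, ?_⟩⟩
    · simp only [hf_sub_left, hf_smul_left]; ring
    · simp only [hf_sub_left, hf_smul_left, hw1, h3]; ring

end hfsec

theorem line_poly {n : ℕ} (f : MvPolynomial (Fin n) ℂ) (z w : Fin n → ℂ) :
    ∃ p : Polynomial ℂ, ∀ t : ℂ, MvPolynomial.eval (z + t • w) f = p.eval t := by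
  induction f using MvPolynomial.induction_on with
  | C a => exact ⟨Polynomial.C a, by simp⟩
  | add f g hf hg =>
    obtain ⟨p, hp⟩ := hf
    obtain ⟨r, hr⟩ := hg
    exact ⟨p + r, fun t => by rw [map_add, hp, hr, Polynomial.eval_add]⟩
  | mul_X f i hf =>
    obtain ⟨p, hp⟩ := hf
    refine ⟨p * (Polynomial.C (z i) + Polynomial.X * Polynomial.C (w i)), fun t => ?_⟩
    rw [map_mul, hp, Polynomial.eval_mul]
    simp only [MvPolynomial.eval_X, Pi.add_apply, Pi.smul_apply, smul_eq_mul, Polynomial.eval_add,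
      Polynomial.eval_mul, Polynomial.eval_C, Polynomial.eval_X]

theorem circle_infinite (τ : ℝ) (hτ : 0 < τ) : {t : ℂ | t * star t = ((τ ^ 2 : ℝ) : ℂ)}.Infinite := by
  have h : (Set.Ioo (0:ℝ) 1).Infinite := Set.Ioo_infinite one_pos
  refine (h.image (f := fun s : ℝ => (⟨τ * s, τ * √(1 - s ^ 2)⟩ : ℂ)) ?_).mono ?_
  · intro x _ y _ hxy
    have := congrArg Complex.re hxy
    simp only at this
    exact mul_left_cancel₀ hτ.ne' this
  · rintro _ ⟨s, ⟨h0, h1⟩, rfl⟩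
    have hs : √(1 - s ^ 2) * √(1 - s ^ 2) = 1 - s ^ 2 := Real.mul_self_sqrt (by nlinarith)
    simp only [Set.mem_ofPred_eq]
    apply Complex.ext
    · simp [-Complex.ofReal_pow]
      linear_combination τ ^ 2 * hs
    · simp [-Complex.ofReal_pow]
      ring

theorem ev_smul {n N d : ℕ} {P : Fin N → MvPolynomial (Fin n) ℂ}
    (hP : ∀ i, (P i).IsHomogeneous d) (c : ℂ) (z : Fin n → ℂ) : ev P (c • z) = c ^ d • ev P z := by
  ext i
  simp only [ev, Pi.smul_apply, smul_eq_mul, MvPolynomial.eval_eq', Finset.mul_sum]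
  refine Finset.sum_congr rfl fun m hm => ?_
  have h := hP i (MvPolynomial.mem_support_iff.1 hm)
  rw [Pi.one_def, ← Finsupp.degree_eq_weight_one, Finsupp.degree_eq_sum] at h
  simp only [mul_pow, Finset.prod_mul_distrib, Finset.prod_pow_eq_pow_sum, h]
  ring

section F1sec
variable {n N d : ℕ} {ε : Fin n → ℂ} {ε' : Fin N → ℂ} {P : Fin N → MvPolynomial (Fin n) ℂ}

theorem orth_a (hε : IsSign ε)
    (hP : ∀ i, (P i).IsHomogeneous d)
    (hnull : ∀ z, hf ε z z = 0 → hf ε' (ev P z) (ev P z) = 0)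
    {z w : Fin n → ℂ} (hz : 0 < (hf ε z z).re) (hw : (hf ε w w).re < 0) (hzw : hf ε z w = 0) :
    hf ε' (ev P z) (ev P w) = 0 := by
  set a := (hf ε z z).re with ha
  set b := (hf ε w w).re with hb
  set τ := √(a / -b) with hτ
  have hτpos : 0 < τ := Real.sqrt_pos.2 (div_pos hz (by linarith))
  have hτ2 : τ ^ 2 = a / -b := Real.sq_sqrt (div_pos hz (by linarith)).le
  choose p hp using fun i => line_poly (P i) z w
  choose r hr using fun i => line_poly (P i) (((τ ^ 2 : ℝ) : ℂ) • w) z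
  let g : Polynomial ℂ := ∑ i, Polynomial.C (ε' i) * (p i * (r i).map (starRingEnd ℂ))
  have hrc : ∀ i t, ((r i).map (starRingEnd ℂ)).eval t
      = star (MvPolynomial.eval (((τ ^ 2 : ℝ) : ℂ) • w + (star t) • z) (P i)) := by
    intro i t
    have h := Polynomial.eval_map_apply (f := starRingEnd ℂ) (p := r i) (star t)
    rw [starRingEnd_apply, star_star] at h
    rw [h, ← hr, starRingEnd_apply]
  have hg : ∀ t, g.eval t = hf ε' (ev P (z + t • w)) (ev P (((τ ^ 2 : ℝ) : ℂ) • w + (star t) • z)) := by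
    intro t
    simp only [g, hf, Polynomial.eval_finsetSum, Polynomial.eval_mul, Polynomial.eval_C, ← hp, hrc,
      ev]
  have hg0 : g = 0 := by
    apply Polynomial.eq_zero_of_infinite_isRoot
    refine (circle_infinite τ hτpos).mono fun t ht => ?_
    simp only [Set.mem_ofPred_eq] at ht ⊢
    rw [Polynomial.IsRoot, hg]
    have e1 : ((τ ^ 2 : ℝ) : ℂ) • w + (star t) • z = (star t) • (z + t • w) := by
      rw [smul_add, smul_smul, ← ht, mul_comm t, add_comm]
    rw [e1, ev_smul hP, hf_smul_right, hnull, mul_zero]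
    have hwz := hf_comm_zero ε hε hzw
    simp only [hf_add_left, hf_add_right, hf_smul_left, hf_smul_right, hzw, hwz]
    rw [hf_self_im ε hε z, hf_self_im ε hε w, ← ha, ← hb]
    have : t * (star t * (b : ℂ)) = - a := by
      rw [← mul_assoc, ht, hτ2]
      have : b ≠ 0 := by linarith
      push_cast
      have : (b : ℂ) ≠ 0 := by exact_mod_cast this
      field_simp
    linear_combination this
  have h0 := hg 0
  rw [hg0] at h0
  simp only [Polynomial.eval_zero, zero_smul, add_zero, star_zero] at h0
  rw [ev_smul hP, hf_smul_right] at h0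
  have h1 := h0.symm
  rcases mul_eq_zero.1 h1 with h | h
  · exfalso
    have : (((τ ^ 2 : ℝ) : ℂ)) ≠ 0 := by exact_mod_cast (pow_pos hτpos 2).ne'
    rw [star_eq_zero] at h
    exact pow_ne_zero _ this h
  · exact h

theorem infinite_line_open {U : Set (Fin n → ℂ)} (hU : IsOpen U) {a : Fin n → ℂ} (ha : a ∈ U)
    (b : Fin n → ℂ) : {t : ℝ | a + (t : ℂ) • b ∈ U}.Infinite := by
  have hcont : Continuous (fun t : ℝ => a + (t : ℂ) • b) := by fun_prop
  have hop : IsOpen ((fun t : ℝ => a + (t : ℂ) • b) ⁻¹' U) := hU.preimage hcont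
  exact infinite_of_mem_nhds (0 : ℝ) (hop.mem_nhds (by simpa using ha))

theorem orth_b (hε : IsSign ε)
    (hP : ∀ i, (P i).IsHomogeneous d)
    (hnull : ∀ z, hf ε z z = 0 → hf ε' (ev P z) (ev P z) = 0)
    (hneg : ∀ z, ∃ w, hf ε z w = 0 ∧ (hf ε w w).re < 0)
    {z w : Fin n → ℂ} (hz : 0 < (hf ε z z).re) (hzw : hf ε z w = 0) :
    hf ε' (ev P z) (ev P w) = 0 := by
  obtain ⟨w0, h1, h2⟩ := hneg z
  have hR : RLP (fun v : Fin n → ℂ => hf ε' (ev P z) (ev P v)) :=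
    RLP.hf _ (fun i => RLP.const _) (RLP.ev (fun i => RLP.coord i) P)
  have := hR.zero_of_infinite w0 (w - w0) ?_ 1
  · simpa using this
  refine (infinite_line_open (isOpen_lt (hf_continuous ε) continuous_const) h2 (w - w0)).mono ?_
  intro t ht
  refine orth_a hε hP hnull hz ht ?_
  rw [hf_add_right, hf_smul_right, hf_sub_right, h1, hzw]; simp

theorem orth (hε : IsSign ε)
    (hP : ∀ i, (P i).IsHomogeneous d)
    (hnull : ∀ z, hf ε z z = 0 → hf ε' (ev P z) (ev P z) = 0)
    (hneg : ∀ z, ∃ w, hf ε z w = 0 ∧ (hf ε w w).re < 0)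
    (hpos : ∀ z, ∃ w, hf ε z w = 0 ∧ 0 < (hf ε w w).re)
    {z w : Fin n → ℂ} (hzw : hf ε z w = 0) :
    hf ε' (ev P z) (ev P w) = 0 := by
  obtain ⟨z0, h1, h2⟩ := hpos w
  have h1 := hf_comm_zero ε hε h1
  have hR : RLP (fun v : Fin n → ℂ => hf ε' (ev P v) (ev P w)) :=
    RLP.hf _ (RLP.ev (fun i => RLP.coord i) P) (fun i => RLP.const _)
  have := hR.zero_of_infinite z0 (z - z0) ?_ 1
  · simpa using this
  refine (infinite_line_open (isOpen_lt continuous_const (hf_continuous ε)) h2 (z - z0)).mono ?_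
  intro t ht
  refine orth_b hε hP hnull hneg ht ?_
  rw [hf_add_left, hf_smul_left, hf_sub_left, h1, hzw]; simp

end F1sec

/-! ## Dimension count -/

structure Dat {n N : ℕ} (d : ℕ) (ε : Fin n → ℂ) (ε' : Fin N → ℂ)
    (P : Fin N → MvPolynomial (Fin n) ℂ) : Prop where
  hε : IsSign ε
  hε' : IsSign ε'
  hP : ∀ i, (P i).IsHomogeneous d
  orth : ∀ z w, hf ε z w = 0 → hf ε' (ev P z) (ev P w) = 0
  pos : ∀ z, 0 < (hf ε z z).re → ev P z ≠ 0 → 0 < (hf ε' (ev P z) (ev P z)).re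
  posex : ∃ z, 0 < (hf ε z z).re
  ne : ∃ z, ev P z ≠ 0

structure FipDat {n N : ℕ} (q q' : ℕ) (ε' : Fin N → ℂ)
    (P : Fin N → MvPolynomial (Fin n) ℂ) (O : Set (Fin q → Fin n → ℂ)) : Prop where
  op : IsOpen O
  nonempty : O.Nonempty
  sub : ∀ v ∈ O, ∃ S : Submodule ℂ (Fin N → ℂ), Module.finrank ℂ S ≤ q' ∧
    (∀ y ∈ S, hf ε' y y = 0 → y = 0) ∧ ∀ c : Fin q → ℂ, ev P (∑ i, c i • v i) ∈ S

def spn {n N m : ℕ} (P : Fin N → MvPolynomial (Fin n) ℂ) (v : Fin m → Fin n → ℂ) :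
    Submodule ℂ (Fin N → ℂ) :=
  Submodule.span ℂ (Set.range fun c : Fin m → ℂ => ev P (∑ i, c i • v i))

section dimsec
variable {n N d : ℕ} {ε : Fin n → ℂ} {ε' : Fin N → ℂ} {P : Fin N → MvPolynomial (Fin n) ℂ}

theorem RLP.lincomb {m : ℕ} {V : Type*} [AddCommGroup V] [Module ℂ V]
    {x : Fin m → V → Fin n → ℂ} (hx : ∀ i j, RLP (fun v => x i v j)) (c : Fin m → ℂ) (j : Fin n) :
    RLP (fun v => (∑ i, c i • x i v) j) := by
  simp only [Finset.sum_apply, Pi.smul_apply, smul_eq_mul]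
  exact RLP.sum _ fun i _ => (RLP.const _).mul (hx i j)

theorem spn_basis {m : ℕ} (v : Fin m → Fin n → ℂ) :
    ∃ c : Fin (Module.finrank ℂ (spn P v)) → Fin m → ℂ,
      LinearIndependent ℂ (fun k => ev P (∑ i, c k i • v i)) := by
  unfold spn
  obtain ⟨f, h1, h2, h3⟩ := Submodule.exists_fun_fin_finrank_span_eq ℂ
    (Set.range fun c : Fin m → ℂ => ev P (∑ i, c i • v i))
  choose c hc using h1
  refine ⟨c, ?_⟩
  exact (funext hc : (fun k => ev P (∑ i, c k i • v i)) = f).symm ▸ h3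

theorem spn_ge {m r : ℕ} (v : Fin m → Fin n → ℂ) (c : Fin r → Fin m → ℂ)
    (h : LinearIndependent ℂ (fun k => ev P (∑ i, c k i • v i))) :
    r ≤ Module.finrank ℂ (spn P v) := by
  have h1 := finrank_span_eq_card h
  rw [Fintype.card_fin] at h1
  rw [← h1]
  apply Submodule.finrank_mono
  apply Submodule.span_mono
  rintro _ ⟨k, rfl⟩
  exact ⟨c k, rfl⟩

theorem spn_semicont {m : ℕ} (v : Fin m → Fin n → ℂ) :
    ∃ D : (Fin m → Fin n → ℂ) → ℂ, RLP D ∧ D v ≠ 0 ∧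
      ∀ v', D v' ≠ 0 → Module.finrank ℂ (spn P v) ≤ Module.finrank ℂ (spn P v') := by
  obtain ⟨c, hc⟩ := spn_basis (P := P) v
  obtain ⟨D, h1, h2, h3⟩ := RLP.semicont
    (x := fun k (v : Fin m → Fin n → ℂ) => ev P (∑ i, c k i • v i))
    (fun k j => RLP.ev (RLP.lincomb (fun i j => RLP.coord2 i j) (c k)) P j) v hc
  exact ⟨D, h1, h2, fun v' hv' => spn_ge v' c (h3 v' hv')⟩

theorem spn_max (P : Fin N → MvPolynomial (Fin n) ℂ) (m : ℕ) : ∃ v : Fin m → Fin n → ℂ,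
    ∀ v' : Fin m → Fin n → ℂ, Module.finrank ℂ (spn P v') ≤ Module.finrank ℂ (spn P v) := by
  have hb : BddAbove (Set.range fun v : Fin m → Fin n → ℂ => Module.finrank ℂ (spn P v)) := by
    refine ⟨N, ?_⟩
    rintro _ ⟨v, rfl⟩
    simpa using Submodule.finrank_le (spn P v)
  obtain ⟨v, hv⟩ := Nat.sSup_mem (Set.range_nonempty _) hb
  exact ⟨v, fun v' => (le_csSup hb ⟨v', rfl⟩).trans hv.ge⟩

theorem Dat.posgen (H : Dat d ε ε' P) {G : (Fin n → ℂ) → ℂ} (hG : RLP G) {w0 : Fin n → ℂ}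
    (h0 : G w0 ≠ 0) : ∃ a, G a ≠ 0 ∧ 0 < (hf ε a a).re ∧
      0 < (hf ε' (ev P a) (ev P a)).re := by
  obtain ⟨z, hz⟩ := H.ne
  obtain ⟨j, hj⟩ := Function.ne_iff.1 hz
  have hR : RLP (fun v : Fin n → ℂ => ev P v j) := RLP.ev (fun i => RLP.coord i) P j
  obtain ⟨v, hv⟩ := hG.mul_ne hR h0 hj
  obtain ⟨u, hu⟩ := H.posex
  obtain ⟨a, ha, ha'⟩ := (hG.mul hR).dense hv (isOpen_lt continuous_const (hf_continuous ε)) hu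
  have h2 : ev P a ≠ 0 := fun h => right_ne_zero_of_mul ha' (by rw [h]; rfl)
  exact ⟨a, left_ne_zero_of_mul ha', ha, H.pos a ha h2⟩

theorem step3 (H : Dat d ε ε' P) {q q' : ℕ} {O : Set (Fin q → Fin n → ℂ)}
    (hO : FipDat q q' ε' P O) (hq : 2 ≤ q) (hqn : q < n) (hq' : q' + 2 ≤ 2 * q) :
    ∃ m, 1 ≤ m ∧ m + 1 ≤ q ∧ ∃ F : (Fin (m + 1) → Fin n → ℂ) → ℂ, RLP F ∧ (∃ x0, F x0 ≠ 0) ∧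
      ∀ x, F x ≠ 0 → ∀ ψ : (Fin N → ℂ) →ₗ[ℂ] ℂ,
        (∀ c : Fin m → ℂ, ψ (ev P (∑ i, c i • x i.succ)) = 0) → ψ (ev P (x 0)) = 0 →
        ∀ c : Fin (m + 1) → ℂ, ψ (ev P (∑ i, c i • x i)) = 0 := by
  choose v hv using spn_max (n := n) P
  have hq1 : Module.finrank ℂ (spn P (v q)) ≤ q' := by
    obtain ⟨D, h1, h2, h3⟩ := spn_semicont (P := P) (v q)
    obtain ⟨u, hu⟩ := hO.nonempty
    obtain ⟨w, hw, hDw⟩ := h1.dense h2 hO.op hu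
    obtain ⟨S, hS1, -, hS2⟩ := hO.sub w hw
    refine ((h3 w hDw).trans (Submodule.finrank_mono ?_)).trans hS1
    rw [spn, Submodule.span_le]
    rintro _ ⟨c, rfl⟩
    exact hS2 c
  have h1 : 1 ≤ Module.finrank ℂ (spn P (v 1)) := by
    obtain ⟨z, hz⟩ := H.ne
    refine le_trans ?_ (hv 1 (fun _ => z))
    refine spn_ge (fun _ => z) (fun _ _ => 1) ?_
    rw [linearIndependent_unique_iff]
    simpa using hz
  obtain ⟨m, hm1, hmq, hm⟩ : ∃ m, 1 ≤ m ∧ m + 1 ≤ q ∧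
      Module.finrank ℂ (spn P (v (m + 1))) ≤ Module.finrank ℂ (spn P (v m)) + 1 := by
    by_contra! hc
    have : ∀ k, k + 1 ≤ q → 2 * k + 1 ≤ Module.finrank ℂ (spn P (v (k + 1))) := by
      intro k
      induction k with
      | zero => intro _; simpa using h1
      | succ k ih =>
        intro hk
        have := ih (by omega)
        have := hc (k + 1) (by omega) hk
        omega
    have := this (q - 1) (by omega)
    rw [Nat.sub_add_cancel (by omega)] at this
    omega
  refine ⟨m, hm1, hmq, ?_⟩
  obtain ⟨D, hD1, hD2, hD3⟩ := spn_semicont (P := P) (v m)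
  obtain ⟨G, hG, ⟨w0, hw0⟩, hGp⟩ := perp_gen ε H.hε (by omega) hD1 (v m) hD2 0
    (fun i => hf_zero_right _ _)
  obtain ⟨a, ha, -, hPa⟩ := H.posgen hG hw0
  obtain ⟨u, hu, hup⟩ := hGp a ha
  have hur : Module.finrank ℂ (spn P u) = Module.finrank ℂ (spn P (v m)) :=
    le_antisymm (hv m u) (hD3 u hu)
  obtain ⟨c, hc⟩ := spn_basis (P := P) u
  let y : Fin (Module.finrank ℂ (spn P u) + 1) → (Fin (m + 1) → Fin n → ℂ) → Fin N → ℂ :=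
    fun k x => Fin.cons (α := fun _ => Fin N → ℂ) (ev P (x 0))
      (fun k => ev P (∑ i, c k i • x i.succ)) k
  have hy0 : LinearIndependent ℂ (fun k => y k (Fin.cons a u)) := by
    have : (fun k => y k (Fin.cons a u)) = (Fin.cons (ev P a)
        (fun k => ev P (∑ i, c k i • u i)) : _ → Fin N → ℂ) := by
      ext k
      simp [y]
    rw [this, linearIndependent_finCons]
    refine ⟨hc, fun hmem => ?_⟩
    have : Submodule.span ℂ (Set.range fun k => ev P (∑ i, c k i • u i))
        ≤ LinearMap.ker (hfl ε' (ev P a)) := by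
      rw [Submodule.span_le]
      rintro _ ⟨k, rfl⟩
      rw [SetLike.mem_coe, LinearMap.mem_ker, hfl_apply]
      apply H.orth
      rw [hf_sum_left]
      exact Finset.sum_eq_zero fun i _ => by rw [hf_smul_left, (hup i).1, mul_zero]
    have := LinearMap.mem_ker.1 (this hmem)
    rw [hfl_apply] at this
    rw [this] at hPa
    simp at hPa
  obtain ⟨F, hF1, hF2, hF3⟩ := RLP.semicont (x := y) (fun k j => by
    refine Fin.cases ?_ (fun k => ?_) k
    · exact RLP.ev (fun i => RLP.coord2 0 i) P j
    · exact RLP.ev (RLP.lincomb (fun i j => RLP.coord2 i.succ j) (c k)) P j) _ hy0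
  refine ⟨F, hF1, ⟨_, hF2⟩, fun x hx ψ hψ hψ0 c' => ?_⟩
  have hli := hF3 x hx
  have hle : Submodule.span ℂ (Set.range fun k => y k x) ≤ spn P x := by
    rw [Submodule.span_le]
    rintro _ ⟨k, rfl⟩
    apply Submodule.subset_span
    refine Fin.cases ?_ (fun k => ?_) k
    · refine ⟨Pi.single 0 1, ?_⟩
      show ev P _ = ev P (x 0)
      congr 1
      simp [Pi.single_apply]
    · refine ⟨Fin.cons 0 (c k), ?_⟩
      show ev P _ = ev P _
      congr 1
      simp [Fin.sum_univ_succ]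
  have heq : Submodule.span ℂ (Set.range fun k => y k x) = spn P x := by
    apply Submodule.eq_of_le_of_finrank_le hle
    rw [finrank_span_eq_card hli, Fintype.card_fin, hur]
    exact (hv _ x).trans hm
  have hker : spn P x ≤ LinearMap.ker ψ := by
    rw [← heq, Submodule.span_le]
    rintro _ ⟨k, rfl⟩
    rw [SetLike.mem_coe, LinearMap.mem_ker]
    refine Fin.cases ?_ (fun k => ?_) k
    · exact hψ0
    · exact hψ (c k)
  exact hker (Submodule.subset_span ⟨c', rfl⟩)

end dimsec

/-! ## Lines are mapped to lines -/

section linesec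
variable {n N d : ℕ} {ε : Fin n → ℂ} {ε' : Fin N → ℂ} {P : Fin N → MvPolynomial (Fin n) ℂ}

def PropA {n N m : ℕ} (P : Fin N → MvPolynomial (Fin n) ℂ)
    (F : (Fin (m + 1) → Fin n → ℂ) → ℂ) : Prop :=
  ∀ x, F x ≠ 0 → ∀ ψ : (Fin N → ℂ) →ₗ[ℂ] ℂ,
    (∀ c : Fin m → ℂ, ψ (ev P (∑ i, c i • x i.succ)) = 0) → ψ (ev P (x 0)) = 0 →
    ∀ c : Fin (m + 1) → ℂ, ψ (ev P (∑ i, c i • x i)) = 0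

theorem RLP.func {V : Type*} [AddCommGroup V] [Module ℂ V] {y : V → Fin N → ℂ}
    (hy : ∀ j, RLP (fun v => y v j)) (ψ : (Fin N → ℂ) →ₗ[ℂ] ℂ) : RLP (fun v => ψ (y v)) := by
  have : ∀ v, ψ (y v) = ∑ k, y v k * ψ (Pi.single k 1) := by
    intro v
    conv_lhs => rw [pi_eq_sum_univ' (y v)]
    simp
  simp only [this]
  exact RLP.sum _ fun k _ => (hy k).mul (RLP.const _)

theorem propag {m : ℕ} (i0 : Fin m) {F : (Fin (m + 1) → Fin n → ℂ) → ℂ} (hF : RLP F)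
    (hA : PropA P F) (V : Submodule ℂ (Fin n → ℂ)) (v : Fin m → Fin n → ℂ) (hv : ∀ i, v i ∈ V)
    (a : Fin n → ℂ) (hFa : F (Fin.cons a v) ≠ 0) (ψ : (Fin N → ℂ) →ₗ[ℂ] ℂ)
    (hψ : ∀ z ∈ V, ψ (ev P z) = 0) (hψa : ψ (ev P a) = 0) (b : Fin n → ℂ) (hb : b ∈ V) (c : ℂ) :
    ψ (ev P (b + c • a)) = 0 := by
  have hR : RLP (fun x : Fin n → ℂ => ψ (ev P x)) :=
    RLP.func (RLP.ev (fun i => RLP.coord i) P) ψ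
  have := hR.zero_of_infinite (v i0) (b + c • a - v i0) ?_ 1
  · simpa using this
  have hK : RLP (fun w : Fin n → ℂ => F (Fin.cons a (Function.update v i0 w))) := by
    refine hF.comp _ fun x y => ⟨Fin.cons 0 (Function.update 0 i0 y), fun t => ?_⟩
    ext k : 1
    refine Fin.cases ?_ (fun k => ?_) k
    · show a = a + (t : ℂ) • 0
      rw [smul_zero, add_zero]
    · show Function.update v i0 _ k = Function.update v i0 _ k
        + (t : ℂ) • (Function.update 0 i0 y : Fin m → Fin n → ℂ) k
      rcases eq_or_ne k i0 with rfl | hk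
      · simp only [Function.update_self]
      · simp only [Function.update_of_ne hk, Pi.zero_apply, smul_zero, add_zero]
  have hfin := hK.finite_zero (v i0) (b - v i0) 0 (by simpa using hFa)
  refine hfin.infinite_compl.mono fun t ht => ?_
  simp only [Set.mem_compl_iff, Set.mem_ofPred_eq] at ht ⊢
  have hmem : ∀ i, Function.update v i0 (v i0 + (t : ℂ) • (b - v i0)) i ∈ V := by
    intro i
    rcases eq_or_ne i i0 with rfl | hk
    · rw [Function.update_self]
      exact V.add_mem (hv _) (V.smul_mem _ (V.sub_mem hb (hv _)))
    · rw [Function.update_of_ne hk]; exact hv i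
  have := hA _ ht ψ (fun c => hψ _ (V.sum_mem fun i _ => V.smul_mem _ (by simpa using hmem i)))
    (by simpa using hψa) (Fin.cons (t * c) (Pi.single i0 1))
  rw [← this]
  congr 2
  rw [Fin.sum_univ_succ]
  simp only [Fin.cons_zero, Fin.cons_succ]
  rw [Finset.sum_eq_single i0]
  · rw [Pi.single_eq_same, Function.update_self]
    module
  · intro i _ hi
    rw [Pi.single_eq_of_ne hi, zero_smul]
  · simp

theorem indep_triple (hP : ∀ i, (P i).IsHomogeneous d) {C : Fin 3 → Fin 2 → ℂ}
    (hC1 : C 1 = ![1, 0]) (hC2 : C 2 = ![0, 1]) {x : Fin 2 → Fin n → ℂ}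
    (h : LinearIndependent ℂ (fun k => ev P (∑ i, C k i • x i))) :
    (∀ c : ℂ, x 0 ≠ c • x 1) ∧ (∀ c : ℂ, x 1 ≠ c • x 0) := by
  have h2 := h.comp ![1, 2] (by decide)
  have e1 : (fun k => ev P (∑ i, C k i • x i)) ∘ ![1, 2] = ![ev P (x 0), ev P (x 1)] := by
    ext k : 1
    fin_cases k
    · simp [hC1]
    · simp [hC2]
  rw [e1, LinearIndependent.pair_iff] at h2
  constructor
  · intro c hc
    have := h2 1 (-c ^ d) (by rw [hc, ev_smul hP]; simp)
    simp at this
  · intro c hc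
    have := h2 (-c ^ d) 1 (by rw [hc, ev_smul hP]; simp)
    simp at this

theorem stepF2 (H : Dat d ε ε' P) {q q' : ℕ} {O : Set (Fin q → Fin n → ℂ)}
    (hO : FipDat q q' ε' P O) (hq : 2 ≤ q) {m : ℕ} (hm : 1 ≤ m) (hmn : m + 1 < n)
    {F : (Fin (m + 1) → Fin n → ℂ) → ℂ} (hF : RLP F) (hF0 : ∃ x0, F x0 ≠ 0) (hA : PropA P F)
    (C : Fin 3 → Fin 2 → ℂ) (hC1 : C 1 = ![1, 0]) (hC2 : C 2 = ![0, 1]) (x0 : Fin 2 → Fin n → ℂ) :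
    ¬ LinearIndependent ℂ (fun k => ev P (∑ i, C k i • x0 i)) := by
  intro hx0
  obtain ⟨D, hD1, hD2, hD3⟩ := RLP.semicont
    (x := fun k (v : Fin 2 → Fin n → ℂ) => ev P (∑ i, C k i • v i))
    (fun k j => RLP.ev (RLP.lincomb (fun i j => RLP.coord2 i j) (C k)) P j) x0 hx0
  obtain ⟨xs, hxs⟩ := hF0
  have hxs' : F (Fin.cons (xs 0) (Fin.tail xs)) ≠ 0 := by rwa [Fin.cons_self_tail]
  have hFv : ∀ a : Fin n → ℂ, RLP (fun v : Fin m → Fin n → ℂ => F (Fin.cons a v)) := fun a =>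
    hF.comp _ fun x y => ⟨Fin.cons 0 y, fun t => by
      ext k : 1
      refine Fin.cases ?_ (fun k => ?_) k <;> simp⟩
  have hFa : ∀ v : Fin m → Fin n → ℂ, RLP (fun a : Fin n → ℂ => F (Fin.cons a v)) := fun v =>
    hF.comp _ fun x y => ⟨Fin.cons y 0, fun t => by
      ext k : 1
      refine Fin.cases ?_ (fun k => ?_) k <;> simp⟩
  obtain ⟨G, hG, ⟨g0, hg0⟩, hGp⟩ := perp_gen ε H.hε hmn (hFv (xs 0)) (Fin.tail xs) hxs' 0
    (fun i => hf_zero_right _ _)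
  obtain ⟨u, hu⟩ := hO.nonempty
  let i0 : Fin q := ⟨0, by omega⟩
  let i1 : Fin q := ⟨1, by omega⟩
  have hi : i1 ≠ i0 := by simp [i0, i1]
  have hDa : RLP (fun a : Fin n → ℂ => D ![a, x0 1]) := hD1.comp _ fun x y => ⟨![y, 0], fun t => by
    ext k : 1
    fin_cases k <;> simp⟩
  obtain ⟨a1, ha1⟩ := hG.mul_ne hDa (b := x0 0) hg0 (by
    have : ![x0 0, x0 1] = x0 := by ext k : 1; fin_cases k <;> rfl
    rwa [this])
  obtain ⟨w1, hw1, hw1'⟩ := (hG.mul hDa).dense ha1 (U := {w | Function.update u i0 w ∈ O})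
    (hO.op.preimage (by fun_prop)) (u := u i0) (by simpa using hu)
  obtain ⟨v1, hv1, hv1p⟩ := hGp w1 (left_ne_zero_of_mul hw1')
  obtain ⟨G', hG', ⟨g1, hg1⟩, hGp'⟩ := perp_gen ε H.hε hmn (hFv (xs 0)) v1 hv1 w1
    (fun i => (hv1p i).1)
  have hDb : RLP (fun a : Fin n → ℂ => D ![w1, a]) := hD1.comp _ fun x y => ⟨![0, y], fun t => by
    ext k : 1
    fin_cases k <;> simp⟩
  obtain ⟨a2, ha2⟩ := hG'.mul_ne hDb (b := x0 1) hg1 (right_ne_zero_of_mul hw1')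
  obtain ⟨w, hw, hw'⟩ := (hG'.mul hDb).dense ha2
    (U := {w | Function.update (Function.update u i0 w1) i1 w ∈ O})
    (hO.op.preimage (by fun_prop)) (u := u i1) (by
      simp only [Set.mem_ofPred_eq]
      have : u i1 = Function.update u i0 w1 i1 := by rw [Function.update_of_ne hi]
      rw [this, Function.update_eq_self]
      exact hw1)
  obtain ⟨v, hv, hvp⟩ := hGp' w (left_ne_zero_of_mul hw')
  have hind := hD3 _ (right_ne_zero_of_mul hw')
  obtain ⟨hne1, hne2⟩ := indep_triple H.hP hC1 hC2 hind
  simp only [Matrix.cons_val_zero, Matrix.cons_val_one] at hne1 hne2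
  have hw1ne : w1 ≠ 0 := fun h => hne1 0 (by simpa using h)
  obtain ⟨a, ha⟩ := (hFa v).mul_ne (RLP.hf ε (fun i => RLP.coord i) (fun i => RLP.const (w1 i)))
    (b := tw ε w1) hv (hf_nondeg ε H.hε hw1ne)
  have haF := left_ne_zero_of_mul ha
  have haw := right_ne_zero_of_mul ha
  set wt : Fin n → ℂ := star (hf ε a w1) • w - star (hf ε a w) • w1 with hwt
  have hwtne : wt ≠ 0 := by
    intro h
    rw [hwt, sub_eq_zero] at h
    refine hne2 ((star (hf ε a w1))⁻¹ * star (hf ε a w)) ?_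
    rw [mul_smul, ← h, smul_smul, inv_mul_cancel₀ (by simpa using haw), one_smul]
  have hwtf : ∀ z, hf ε z wt = hf ε a w1 * hf ε z w - hf ε a w * hf ε z w1 := by
    intro z
    rw [hwt, hf_sub_right, hf_smul_right, hf_smul_right, star_star, star_star]
  obtain ⟨a', ha'⟩ := (hFa v).mul_ne (RLP.hf ε (fun i => RLP.coord i) (fun i => RLP.const (wt i)))
    (b := tw ε wt) hv (hf_nondeg ε H.hε hwtne)
  have haF' := left_ne_zero_of_mul ha'
  have haw' := right_ne_zero_of_mul ha'
  let y : Fin 3 → Fin N → ℂ := fun k => ev P (∑ i, C k i • (![w1, w] : Fin 2 → Fin n → ℂ) i)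
  let T : (Fin 3 → ℂ) →ₗ[ℂ] (Fin 2 → ℂ) := LinearMap.pi
    ![(hfl ε' (ev P a)).comp (Fintype.linearCombination ℂ y),
      (hfl ε' (ev P a')).comp (Fintype.linearCombination ℂ y)]
  have hT : LinearMap.ker T ≠ ⊥ := LinearMap.ker_ne_bot_of_finrank_lt (by simp)
  obtain ⟨g, hg, hgne⟩ := (Submodule.ne_bot_iff _).1 hT
  have hg' : ∀ k, T g k = 0 := fun k => by rw [LinearMap.mem_ker.1 hg]; rfl
  set Y : Fin N → ℂ := ∑ k, g k • y k with hY
  have hYa : hf ε' Y (ev P a) = 0 := hg' 0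
  have hYa' : hf ε' Y (ev P a') = 0 := hg' 1
  let V : Submodule ℂ (Fin n → ℂ) := LinearMap.ker (hfl ε w1) ⊓ LinearMap.ker (hfl ε w)
  have hV : ∀ z, z ∈ V ↔ hf ε z w1 = 0 ∧ hf ε z w = 0 := fun z => by simp [V]
  have hψV : ∀ z ∈ V, hfl ε' Y (ev P z) = 0 := by
    intro z hz
    rw [hV] at hz
    rw [hfl_apply]
    apply hf_comm_zero ε' H.hε'
    rw [hY, hf_sum_left]
    refine Finset.sum_eq_zero fun k _ => ?_
    rw [hf_smul_left, H.orth, mul_zero]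
    apply hf_comm_zero ε H.hε
    simp [Fin.sum_univ_two, hf_add_right, hf_smul_right, hz.1, hz.2]
  have hvV : ∀ i, v i ∈ V := fun i => (hV _).2 ⟨(hvp i).2, (hvp i).1⟩
  have hψ2 : ∀ z ∈ V ⊔ Submodule.span ℂ {a}, hfl ε' Y (ev P z) = 0 := by
    intro z hz
    obtain ⟨b, hb, a2, ha2, rfl⟩ := Submodule.mem_sup.1 hz
    obtain ⟨c, rfl⟩ := Submodule.mem_span_singleton.1 ha2
    exact propag ⟨0, hm⟩ hF hA V v hvV a haF _ hψV (hf_comm_zero ε' H.hε' hYa) b hb c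
  have hψ3 : ∀ z, hfl ε' Y (ev P z) = 0 := by
    intro z
    set c' := hf ε z wt / hf ε a' wt with hc'
    set c := (hf ε z w1 - c' * hf ε a' w1) / hf ε a w1 with hc
    have hb1 : hf ε (z - c • a - c' • a') w1 = 0 := by
      rw [hf_sub_left, hf_sub_left, hf_smul_left, hf_smul_left, hc, div_mul_cancel₀ _ haw]; ring
    have hb2 : hf ε (z - c • a - c' • a') wt = 0 := by
      rw [hf_sub_left, hf_sub_left, hf_smul_left, hf_smul_left, hc', div_mul_cancel₀ _ haw',
        hwtf a]; ring
    have hb3 : hf ε (z - c • a - c' • a') w = 0 := by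
      rw [hwtf, hb1, mul_zero, sub_zero] at hb2
      exact (mul_eq_zero.1 hb2).resolve_left haw
    have hbV : z - c • a - c' • a' ∈ V := (hV _).2 ⟨hb1, hb3⟩
    have := propag ⟨0, hm⟩ hF hA (V ⊔ Submodule.span ℂ {a}) v
      (fun i => Submodule.mem_sup_left (hvV i)) a' haF' _ hψ2 (hf_comm_zero ε' H.hε' hYa')
      ((z - c • a - c' • a') + c • a) (Submodule.add_mem_sup hbV
        (Submodule.smul_mem _ _ (Submodule.mem_span_singleton_self a))) c'
    convert this using 3
    module
  have hYY : hf ε' Y Y = 0 := by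
    conv_lhs => rw [hY]
    rw [hf_sum_left]
    refine Finset.sum_eq_zero fun k _ => ?_
    rw [hf_smul_left]
    have := hψ3 (∑ i, C k i • (![w1, w] : Fin 2 → Fin n → ℂ) i)
    rw [hfl_apply] at this
    rw [← hY, this, mul_zero]
  obtain ⟨S, -, hS1, hS2⟩ := hO.sub _ hw
  have hY0 : Y = 0 := by
    apply hS1 _ _ hYY
    refine S.sum_mem fun k _ => S.smul_mem _ ?_
    have := hS2 (Pi.single i0 (C k 0) + Pi.single i1 (C k 1))
    convert this using 2
    simp only [Pi.add_apply, add_smul, Finset.sum_add_distrib]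
    rw [Finset.sum_eq_single i0, Finset.sum_eq_single i1]
    · simp [Function.update_of_ne hi.symm, Fin.sum_univ_two]
    · intro i _ h; rw [Pi.single_eq_of_ne h, zero_smul]
    · simp
    · intro i _ h; rw [Pi.single_eq_of_ne h, zero_smul]
    · simp
  exact hgne (funext fun k => Fintype.linearIndependent_iff.1 hind g hY0 k)

theorem F2_mem (H : Dat d ε ε' P) {q q' : ℕ} {O : Set (Fin q → Fin n → ℂ)}
    (hO : FipDat q q' ε' P O) (hq : 2 ≤ q) (hqn : q < n) (hq' : q' + 2 ≤ 2 * q)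
    {w1 w : Fin n → ℂ} (hw : LinearIndependent ℂ ![ev P w1, ev P w]) (s t : ℂ) :
    ev P (s • w1 + t • w) ∈ Submodule.span ℂ (Set.range ![ev P w1, ev P w]) := by
  obtain ⟨m, hm1, hmq, F, hF, hF0, hA⟩ := step3 H hO hq hqn hq'
  by_contra hc
  refine stepF2 H hO hq hm1 (by omega) hF hF0 hA ![![s, t], ![1, 0], ![0, 1]] rfl rfl ![w1, w] ?_
  have h3 := linearIndependent_finCons.2 ⟨hw, hc⟩
  have e : (fun k => ev P (∑ i, (![![s, t], ![1, 0], ![0, 1]] : Fin 3 → Fin 2 → ℂ) k i •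
      (![w1, w] : Fin 2 → Fin n → ℂ) i)) = Fin.cons (ev P (s • w1 + t • w)) ![ev P w1, ev P w] := by
    ext k : 1
    fin_cases k <;> simp [Fin.sum_univ_two]
  rw [e]
  exact h3

end linesec

/-! ## Derivatives, linear forms -/

section dersec
variable {n N d : ℕ}

theorem dvd_linear {ε : Fin n → ℂ} (hε : IsSign ε) {b : Fin n → ℂ} (hb : b ≠ 0)
    (f : MvPolynomial (Fin n) ℂ) (hfz : ∀ z, hf ε z b = 0 → MvPolynomial.eval z f = 0) :
    ∃ R : MvPolynomial (Fin n) ℂ, ∀ z, MvPolynomial.eval z f = hf ε z b * MvPolynomial.eval z R := by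
  let l : MvPolynomial (Fin n) ℂ := ∑ i, MvPolynomial.C (ε i * star (b i)) * MvPolynomial.X i
  have hl : ∀ z, MvPolynomial.eval z l = hf ε z b := by
    intro z
    simp only [l, map_sum, map_mul, MvPolynomial.eval_C, MvPolynomial.eval_X, hf]
    exact Finset.sum_congr rfl fun i _ => by ring
  let u : Fin n → ℂ := (hf ε (tw ε b) b)⁻¹ • tw ε b
  have hu : hf ε u b = 1 := by rw [hf_smul_left, inv_mul_cancel₀ (hf_nondeg ε hε hb)]
  let σ : Fin n → MvPolynomial (Fin n) ℂ := fun i => MvPolynomial.X i - MvPolynomial.C (u i) * l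
  have h0 : MvPolynomial.bind₁ σ f = 0 := by
    apply MvPolynomial.funext
    intro z
    rw [map_zero]
    show MvPolynomial.aeval z (MvPolynomial.bind₁ σ f) = 0
    rw [MvPolynomial.aeval_bind₁]
    have : (fun i => (MvPolynomial.aeval z) (σ i)) = z - hf ε z b • u := by
      ext i
      rw [MvPolynomial.aeval_eq_eval]
      simp only [σ, map_sub, map_mul, MvPolynomial.eval_X, MvPolynomial.eval_C, hl, Pi.sub_apply,
        Pi.smul_apply, smul_eq_mul]
      ring
    rw [this, MvPolynomial.aeval_eq_eval]
    apply hfz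
    rw [hf_sub_left, hf_smul_left, hu]; ring
  have h1 : (Ideal.Quotient.mkₐ ℂ (Ideal.span {l})).comp (MvPolynomial.bind₁ σ)
      = Ideal.Quotient.mkₐ ℂ (Ideal.span {l}) := by
    apply MvPolynomial.algHom_ext
    intro i
    rw [AlgHom.comp_apply, MvPolynomial.bind₁_X_right]
    simp only [σ, Ideal.Quotient.mkₐ_eq_mk]
    rw [Ideal.Quotient.eq]
    have : MvPolynomial.X i - MvPolynomial.C (u i) * l - MvPolynomial.X i
      = - MvPolynomial.C (u i) * l := by ring
    rw [this]
    exact Ideal.mul_mem_left _ _ (Ideal.mem_span_singleton_self l)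
  have h2 := AlgHom.congr_fun h1 f
  rw [AlgHom.comp_apply, h0, map_zero] at h2
  have h3 : f ∈ Ideal.span {l} := by
    rw [← Ideal.Quotient.eq_zero_iff_mem]
    exact h2.symm
  obtain ⟨R, hR⟩ := Ideal.mem_span_singleton.1 h3
  exact ⟨R, fun z => by rw [hR, map_mul, hl]⟩

/-- directional derivative -/
noncomputable def dv (f : MvPolynomial (Fin n) ℂ) (z x : Fin n → ℂ) : ℂ :=
  ∑ j, MvPolynomial.eval z (MvPolynomial.pderiv j f) * x j

noncomputable def lnp (f : MvPolynomial (Fin n) ℂ) (z x : Fin n → ℂ) : Polynomial ℂ :=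
  MvPolynomial.aeval (fun i => Polynomial.C (z i) + Polynomial.X * Polynomial.C (x i)) f

theorem lnp_eval (f : MvPolynomial (Fin n) ℂ) (z x : Fin n → ℂ) (t : ℂ) :
    (lnp f z x).eval t = MvPolynomial.eval (z + t • x) f := by
  unfold lnp
  induction f using MvPolynomial.induction_on with
  | C a => simp
  | add p r hp hr => simp only [map_add, Polynomial.eval_add, hp, hr]
  | mul_X p i hp =>
    simp only [map_mul, Polynomial.eval_mul, hp, MvPolynomial.aeval_X, MvPolynomial.eval_X,
      Polynomial.eval_add, Polynomial.eval_C, Polynomial.eval_X, Pi.add_apply, Pi.smul_apply,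
      smul_eq_mul]

theorem lnp_deriv (f : MvPolynomial (Fin n) ℂ) (z x : Fin n → ℂ) :
    Polynomial.derivative (lnp f z x)
      = ∑ j, lnp (MvPolynomial.pderiv j f) z x * Polynomial.C (x j) := by
  unfold lnp
  induction f using MvPolynomial.induction_on with
  | C a => simp
  | add p r hp hr => simp only [map_add, hp, hr, add_mul, Finset.sum_add_distrib]
  | mul_X p i hp =>
    simp only [map_mul, Polynomial.derivative_mul, hp, MvPolynomial.aeval_X,
      MvPolynomial.pderiv_mul, map_add, add_mul, Finset.sum_add_distrib, Finset.sum_mul]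
    refine congrArg₂ (· + ·) ?_ ?_
    · exact Finset.sum_congr rfl fun j _ => by ring
    · rw [Finset.sum_eq_single i]
      · simp
      · intro j _ hj
        simp [MvPolynomial.pderiv_X_of_ne hj.symm]
      · simp

theorem lnp_deriv_eval (f : MvPolynomial (Fin n) ℂ) (z x : Fin n → ℂ) (t : ℂ) :
    (Polynomial.derivative (lnp f z x)).eval t = dv f (z + t • x) x := by
  rw [lnp_deriv, Polynomial.eval_finsetSum, dv]
  exact Finset.sum_congr rfl fun j _ => by rw [Polynomial.eval_mul, lnp_eval, Polynomial.eval_C]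

theorem dv_zero_of_line {f : MvPolynomial (Fin n) ℂ} {z x : Fin n → ℂ}
    (h : ∀ t : ℂ, MvPolynomial.eval (z + t • x) f = 0) : dv f z x = 0 := by
  have : lnp f z x = 0 := by
    apply Polynomial.funext
    intro t
    rw [lnp_eval, h]; simp
  have h2 := lnp_deriv_eval f z x 0
  rw [this] at h2
  simpa using h2.symm

theorem dv_mul (f g : MvPolynomial (Fin n) ℂ) (z x : Fin n → ℂ) :
    dv (f * g) z x = dv f z x * MvPolynomial.eval z g + MvPolynomial.eval z f * dv g z x := by
  simp only [dv, MvPolynomial.pderiv_mul, map_add, map_mul, Finset.sum_mul, Finset.mul_sum,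
    ← Finset.sum_add_distrib]
  exact Finset.sum_congr rfl fun j _ => by ring

/-- derivative vector -/
noncomputable def Dv (P : Fin N → MvPolynomial (Fin n) ℂ) (z x : Fin n → ℂ) : Fin N → ℂ :=
  fun i => dv (P i) z x

/-- composition with a functional -/
noncomputable def fp (P : Fin N → MvPolynomial (Fin n) ℂ) (ψ : (Fin N → ℂ) →ₗ[ℂ] ℂ) :
    MvPolynomial (Fin n) ℂ := ∑ i, MvPolynomial.C (ψ (Pi.single i 1)) * P i

theorem func_eq (ψ : (Fin N → ℂ) →ₗ[ℂ] ℂ) (y : Fin N → ℂ) :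
    ψ y = ∑ k, ψ (Pi.single k 1) * y k := by
  conv_lhs => rw [pi_eq_sum_univ' y]
  simp [mul_comm]

theorem fp_eval (P : Fin N → MvPolynomial (Fin n) ℂ) (ψ : (Fin N → ℂ) →ₗ[ℂ] ℂ) (z : Fin n → ℂ) :
    MvPolynomial.eval z (fp P ψ) = ψ (ev P z) := by
  rw [func_eq]
  simp [fp, ev]

theorem fp_dv (P : Fin N → MvPolynomial (Fin n) ℂ) (ψ : (Fin N → ℂ) →ₗ[ℂ] ℂ) (z x : Fin n → ℂ) :
    dv (fp P ψ) z x = ψ (Dv P z x) := by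
  rw [func_eq ψ]
  simp only [fp, dv, Dv, map_sum, MvPolynomial.pderiv_C_mul, Finset.sum_mul, Finset.mul_sum]
  rw [Finset.sum_comm]
  refine Finset.sum_congr rfl fun i _ => Finset.sum_congr rfl fun j _ => ?_
  rw [RingHom.map_mul, MvPolynomial.eval_C]
  ring

theorem RLP.dv {V : Type*} [AddCommGroup V] [Module ℂ V] {f g : V → Fin n → ℂ}
    (h1 : ∀ i, RLP (fun v => f v i)) (h2 : ∀ i, RLP (fun v => g v i)) (F : MvPolynomial (Fin n) ℂ) :
    RLP (fun v => dv F (f v) (g v)) :=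
  RLP.sum _ fun i _ => (RLP.eval h1 _).mul (h2 i)

theorem dv_hf {ε : Fin n → ℂ} (hε : IsSign ε) {b : Fin n → ℂ}
    {f R : MvPolynomial (Fin n) ℂ}
    (hR : ∀ z, MvPolynomial.eval z f = hf ε z b * MvPolynomial.eval z R) {w1 : Fin n → ℂ}
    (hw : hf ε w1 b = 0) (w : Fin n → ℂ) : dv f w1 w = hf ε w b * MvPolynomial.eval w1 R := by
  have e : lnp f w1 w = Polynomial.X * Polynomial.C (hf ε w b) * lnp R w1 w := by
    apply Polynomial.funext
    intro t
    rw [lnp_eval, hR, Polynomial.eval_mul, lnp_eval, hf_add_left, hf_smul_left, hw]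
    simp only [Polynomial.eval_mul, Polynomial.eval_X, Polynomial.eval_C]
    ring
  have h2 := lnp_deriv_eval f w1 w 0
  rw [e] at h2
  simp only [Polynomial.derivative_mul, Polynomial.derivative_X, Polynomial.eval_add,
    Polynomial.eval_mul, Polynomial.eval_X, lnp_eval, zero_smul, add_zero, Polynomial.eval_C] at h2
  rw [← h2]; simp

/-- vanishing wronskian -/
theorem wronsk {p1 p2 : Polynomial ℂ} (h : Polynomial.derivative p1 * p2
    = Polynomial.derivative p2 * p1) (h1 : p1.eval 0 ≠ 0) (h2 : p2.eval 0 = 0) : p2 = 0 := by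
  by_contra hne
  have hd : Polynomial.derivative p2 ≠ 0 := by
    intro hd
    have := Polynomial.derivative_eq_zero.1 hd
    rw [Polynomial.eq_C_of_natDegree_eq_zero this] at h2 hne
    simp only [Polynomial.eval_C] at h2
    rw [h2] at hne; simp at hne
  have hp1 : p1 ≠ 0 := fun h => by rw [h] at h1; simp at h1
  have hm := Polynomial.derivative_rootMultiplicity_of_root (p := p2) (t := 0) h2
  have hpos : 0 < p2.rootMultiplicity 0 := (Polynomial.rootMultiplicity_pos hne).2 h2
  have h10 : p1.rootMultiplicity 0 = 0 := Polynomial.rootMultiplicity_eq_zero h1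
  have hr := Polynomial.rootMultiplicity_mul (x := (0:ℂ)) (mul_ne_zero hd hp1)
  have hl := Polynomial.rootMultiplicity_mul (x := (0:ℂ)) (h ▸ mul_ne_zero hd hp1)
  rw [h] at hl
  omega

end dersec

/-! ## Linearity -/

section linsec
variable {n N d : ℕ} {ε : Fin n → ℂ} {ε' : Fin N → ℂ} {P : Fin N → MvPolynomial (Fin n) ℂ}

theorem RLP.Dvec {V : Type*} [AddCommGroup V] [Module ℂ V] {f g : V → Fin n → ℂ}
    (h1 : ∀ i, RLP (fun v => f v i)) (h2 : ∀ i, RLP (fun v => g v i))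
    (P : Fin N → MvPolynomial (Fin n) ℂ) (j : Fin N) :
    RLP (fun v => Dv P (f v) (g v) j) :=
  RLP.dv h1 h2 (P j)

theorem RLP.psiDz (P : Fin N → MvPolynomial (Fin n) ℂ) (ψ : (Fin N → ℂ) →ₗ[ℂ] ℂ) (x : Fin n → ℂ) :
    RLP (fun z : Fin n → ℂ => ψ (Dv P z x)) :=
  RLP.func (y := fun z : Fin n → ℂ => Dv P z x)
    (RLP.Dvec (f := fun z => z) (g := fun _ => x) (fun i => RLP.coord i)
      (fun i => RLP.const (x i)) P) ψ

theorem RLP.psiDx (P : Fin N → MvPolynomial (Fin n) ℂ) (ψ : (Fin N → ℂ) →ₗ[ℂ] ℂ) (z : Fin n → ℂ) :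
    RLP (fun x : Fin n → ℂ => ψ (Dv P z x)) :=
  RLP.func (y := fun x : Fin n → ℂ => Dv P z x)
    (RLP.Dvec (f := fun _ => z) (g := fun x => x) (fun i => RLP.const (z i))
      (fun i => RLP.coord i) P) ψ

theorem RLP.psiP (P : Fin N → MvPolynomial (Fin n) ℂ) (ψ : (Fin N → ℂ) →ₗ[ℂ] ℂ) :
    RLP (fun x : Fin n → ℂ => ψ (_root_.ev P x)) :=
  RLP.func (RLP.ev (fun i => RLP.coord i) P) ψ

def LineP {n N : ℕ} (P : Fin N → MvPolynomial (Fin n) ℂ) : Prop :=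
  ∀ w1 w : Fin n → ℂ, LinearIndependent ℂ ![ev P w1, ev P w] → ∀ s t : ℂ,
    ev P (s • w1 + t • w) ∈ Submodule.span ℂ (Set.range ![ev P w1, ev P w])

theorem E0 (hL : LineP P) {w1 w : Fin n → ℂ} (hi : LinearIndependent ℂ ![ev P w1, ev P w]) :
    ∃ α β : ℂ, Dv P w1 w = α • ev P w1 + β • ev P w := by
  have hr : Set.range ![ev P w1, ev P w] = {ev P w1, ev P w} := by
    simp [Matrix.range_cons, Set.pair_comm]
  have hmem : Dv P w1 w ∈ Submodule.span ℂ (Set.range ![ev P w1, ev P w]) := by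
    by_contra hc
    obtain ⟨ψ, h1, h2⟩ := Submodule.exists_le_ker_of_notMem hc
    apply h1
    rw [← fp_dv]
    apply dv_zero_of_line
    intro t
    rw [fp_eval]
    have := h2 (hL w1 w hi 1 t)
    rwa [one_smul] at this
  rw [hr, Submodule.mem_span_pair] at hmem
  obtain ⟨α, β, h⟩ := hmem
  exact ⟨α, β, h.symm⟩

theorem exists_pair (H : Dat d ε ε' P) (hn : 2 < n) :
    ∃ D : (Fin 2 → Fin n → ℂ) → ℂ, RLP D ∧ (∃ x0, D x0 ≠ 0) ∧
      ∀ x, D x ≠ 0 → LinearIndependent ℂ ![ev P (x 0), ev P (x 1)] := by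
  obtain ⟨z, hz⟩ := H.ne
  obtain ⟨j, hj⟩ := Function.ne_iff.1 hz
  have hR : RLP (fun v : Fin 1 → Fin n → ℂ => ev P (v 0) j) := RLP.ev (fun i => RLP.coord2 0 i) P j
  obtain ⟨G, hG, ⟨g0, hg0⟩, hGp⟩ := perp_gen ε H.hε (by omega) hR (fun _ => z) hj 0
    (fun i => hf_zero_right _ _)
  obtain ⟨a, ha, -, hPa⟩ := H.posgen hG hg0
  obtain ⟨v, hv, hvp⟩ := hGp a ha
  have hli : LinearIndependent ℂ (fun k => (fun (k : Fin 2) (x : Fin 2 → Fin n → ℂ) => ev P (x k)) k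
      ![a, v 0]) := by
    have e : (fun k => (fun (k : Fin 2) (x : Fin 2 → Fin n → ℂ) => ev P (x k)) k ![a, v 0])
      = ![ev P a, ev P (v 0)] := by
      ext k : 1
      fin_cases k <;> rfl
    rw [e, LinearIndependent.pair_iff]
    intro s t hst
    have h1 : hf ε' (s • ev P a + t • ev P (v 0)) (ev P a) = 0 := by rw [hst, hf_zero_left]
    rw [hf_add_left, hf_smul_left, hf_smul_left, H.orth (v 0) a (hvp 0).1, mul_zero, add_zero] at h1
    have hs : s = 0 := (mul_eq_zero.1 h1).resolve_right (fun h => by rw [h] at hPa; simp at hPa)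
    rw [hs, zero_smul, zero_add] at hst
    have ht : t = 0 := (smul_eq_zero.1 hst).resolve_right (fun h => hv (by
      show ev P (v 0) j = 0
      rw [h]; rfl))
    exact ⟨hs, ht⟩
  obtain ⟨D, hD1, hD2, hD3⟩ := RLP.semicont
    (x := fun (k : Fin 2) (x : Fin 2 → Fin n → ℂ) => ev P (x k))
    (fun k j => RLP.ev (fun i => RLP.coord2 k i) P j) _ hli
  refine ⟨D, hD1, ⟨_, hD2⟩, fun x hx => ?_⟩
  have := hD3 x hx
  have e : (fun k : Fin 2 => ev P (x k)) = ![ev P (x 0), ev P (x 1)] := by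
    ext k : 1
    fin_cases k <;> rfl
  rwa [e] at this

/-- for fixed first vector -/
theorem pair_gen {w1 w : Fin n → ℂ} (hi : LinearIndependent ℂ ![ev P w1, ev P w]) :
    ∃ D : (Fin n → ℂ) → ℂ, RLP D ∧ D w ≠ 0 ∧
      ∀ x, D x ≠ 0 → LinearIndependent ℂ ![ev P w1, ev P x] := by
  obtain ⟨D, hD1, hD2, hD3⟩ := RLP.semicont
    (x := fun (k : Fin 2) (x : Fin n → ℂ) => (![ev P w1, ev P x] : Fin 2 → Fin N → ℂ) k)
    (fun k j => by
      fin_cases k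
      · exact RLP.const _
      · exact RLP.ev (fun i => RLP.coord i) P j) w hi
  exact ⟨D, hD1, hD2, hD3⟩

theorem E1 (H : Dat d ε ε' P) (hL : LineP P) {b : Fin n → ℂ} (hb : b ≠ 0)
    {R : MvPolynomial (Fin n) ℂ}
    (hR : ∀ z, hf ε' (ev P z) (ev P b) = hf ε z b * MvPolynomial.eval z R)
    {w1 w0 : Fin n → ℂ} (hw1 : hf ε w1 b = 0)
    (hi : LinearIndependent ℂ ![ev P w1, ev P w0]) (ψ : (Fin N → ℂ) →ₗ[ℂ] ℂ)
    (hψ : ψ (ev P w1) = 0) (w : Fin n → ℂ) :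
    MvPolynomial.eval w R * ψ (Dv P w1 w) = MvPolynomial.eval w1 R * ψ (ev P w) := by
  obtain ⟨D, hD1, hD2, hD3⟩ := pair_gen hi
  have hl : RLP (fun z : Fin n → ℂ => hf ε z b) := RLP.hf ε (fun i => RLP.coord i)
    (fun i => RLP.const _)
  have hK : RLP (fun z : Fin n → ℂ => MvPolynomial.eval z R * ψ (Dv P w1 z)
      - MvPolynomial.eval w1 R * ψ (ev P z)) := by
    exact ((RLP.eval (fun i => RLP.coord i) R).mul (RLP.psiDx P ψ w1)).sub
      ((RLP.const _).mul (RLP.psiP P ψ))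
  by_contra hne
  obtain ⟨x, hx⟩ := hl.mul_ne hD1 (hf_nondeg ε H.hε hb) hD2
  obtain ⟨x, hx⟩ := (hl.mul hD1).mul_ne hK hx (sub_ne_zero.2 hne)
  have hx3 := right_ne_zero_of_mul hx
  have hx1 := left_ne_zero_of_mul (left_ne_zero_of_mul hx)
  have hx2 := hD3 x (right_ne_zero_of_mul (left_ne_zero_of_mul hx))
  apply hx3
  obtain ⟨α, β, hαβ⟩ := E0 hL hx2
  have h1 := dv_hf (f := fp P (hfl ε' (ev P b))) (R := R) H.hε
    (fun z => by rw [fp_eval, hfl_apply]; exact hR z) hw1 x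
  rw [fp_dv, hfl_apply, hαβ, hf_add_left, hf_smul_left, hf_smul_left, H.orth _ _ hw1, hR x] at h1
  have h2 : β * MvPolynomial.eval x R = MvPolynomial.eval w1 R :=
    mul_left_cancel₀ hx1 (by linear_combination h1)
  rw [hαβ, map_add, map_smul, map_smul, hψ, ← h2]
  simp only [smul_eq_mul]
  ring

theorem not_parallel (hP : ∀ i, (P i).IsHomogeneous d)
    (h : ∀ z x (ψ1 ψ2 : (Fin N → ℂ) →ₗ[ℂ] ℂ),
      ψ1 (Dv P z x) * ψ2 (ev P z) = ψ2 (Dv P z x) * ψ1 (ev P z)) (z x : Fin n → ℂ) :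
    ¬ LinearIndependent ℂ ![ev P z, ev P x] := by
  intro hi
  rw [LinearIndependent.pair_iff] at hi
  obtain ⟨ψ1, h1⟩ : ∃ ψ : (Fin N → ℂ) →ₗ[ℂ] ℂ, ψ (ev P z) ≠ 0 := by
    have : ev P z ∉ (⊥ : Submodule ℂ (Fin N → ℂ)) := fun h => by
      have := hi 1 0 (by simp [(Submodule.mem_bot ℂ).1 h])
      simp at this
    obtain ⟨ψ, hψ, -⟩ := Submodule.exists_le_ker_of_notMem this
    exact ⟨ψ, hψ⟩
  obtain ⟨ψ2, h2, h3⟩ : ∃ ψ : (Fin N → ℂ) →ₗ[ℂ] ℂ, ψ (ev P x) ≠ 0 ∧ ψ (ev P z) = 0 := by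
    have : ev P x ∉ Submodule.span ℂ {ev P z} := fun h => by
      obtain ⟨c, hc⟩ := Submodule.mem_span_singleton.1 h
      have := hi c (-1) (by rw [hc]; simp)
      simp at this
    obtain ⟨ψ, hψ, hk⟩ := Submodule.exists_le_ker_of_notMem this
    exact ⟨ψ, hψ, hk (Submodule.mem_span_singleton_self _)⟩
  have hw : lnp (fp P ψ2) z x = 0 := by
    refine wronsk (p1 := lnp (fp P ψ1) z x) ?_ ?_ ?_
    · apply Polynomial.funext
      intro t
      rw [Polynomial.eval_mul, Polynomial.eval_mul, lnp_deriv_eval, lnp_deriv_eval, lnp_eval,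
        lnp_eval, fp_dv, fp_dv, fp_eval, fp_eval]
      exact h _ _ _ _
    · rw [lnp_eval, fp_eval, zero_smul, add_zero]; exact h1
    · rw [lnp_eval, fp_eval, zero_smul, add_zero]; exact h3
  have hz : ∀ t : ℂ, ψ2 (ev P (z + t • x)) = 0 := by
    intro t
    rw [← fp_eval, ← lnp_eval, hw]; simp
  apply h2
  have hR : RLP (fun v : Fin n → ℂ => ψ2 (ev P v)) :=
    RLP.func (RLP.ev (fun i => RLP.coord i) P) ψ2
  have := hR.zero_of_infinite x z ?_ 0
  · simpa using this
  refine (Set.finite_singleton (0:ℝ)).infinite_compl.mono fun s hs => ?_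
  have hs' : (s : ℂ) ≠ 0 := by simpa using hs
  have e : x + (s : ℂ) • z = (s : ℂ) • (z + (s : ℂ)⁻¹ • x) := by
    rw [smul_add, smul_smul, mul_inv_cancel₀ hs', one_smul, add_comm]
  show ψ2 (ev P (x + (s : ℂ) • z)) = 0
  rw [e, ev_smul hP, map_smul, hz, smul_zero]

theorem exists_R (H : Dat d ε ε' P) {b : Fin n → ℂ} (hb : b ≠ 0) :
    ∃ R : MvPolynomial (Fin n) ℂ,
      ∀ z, hf ε' (ev P z) (ev P b) = hf ε z b * MvPolynomial.eval z R := by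
  obtain ⟨R, hR⟩ := dvd_linear H.hε hb (fp P (hfl ε' (ev P b))) (fun z hz => by
    rw [fp_eval, hfl_apply]; exact H.orth _ _ hz)
  exact ⟨R, fun z => by rw [← hR, fp_eval, hfl_apply]⟩

theorem good_b (H : Dat d ε ε' P) (hL : LineP P) (hn : 3 < n) (hd : 1 ≤ d) :
    ∃ b : Fin n → ℂ, b ≠ 0 ∧ ∃ R : MvPolynomial (Fin n) ℂ,
      (∀ z, hf ε' (ev P z) (ev P b) = hf ε z b * MvPolynomial.eval z R) ∧
      (∃ w, hf ε w b = 0 ∧ MvPolynomial.eval w R ≠ 0) ∧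
      (∃ w1 w2, hf ε w1 b = 0 ∧ hf ε w2 b = 0 ∧ LinearIndependent ℂ ![ev P w1, ev P w2]) := by
  obtain ⟨D, hD, ⟨x0, hx0⟩, hDi⟩ := exists_pair H (by omega)
  obtain ⟨G1, hG1, ⟨g0, hg0⟩, hGp⟩ := perp_gen ε H.hε (by omega) hD x0 hx0 0
    (fun i => hf_zero_right _ _)
  obtain ⟨a, ha, -, hPa⟩ := H.posgen hG1 hg0
  have hG2 : RLP (fun v : Fin 1 → Fin n → ℂ => G1 (v 0) * hf ε' (ev P (v 0)) (ev P (v 0))) := by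
    refine (hG1.comp (fun v : Fin 1 → Fin n → ℂ => v 0) fun x y => ⟨y 0, fun t => rfl⟩).mul ?_
    exact RLP.hf ε' (RLP.ev (fun i => RLP.coord2 0 i) P) (RLP.ev (fun i => RLP.coord2 0 i) P)
  have hab : G1 a * hf ε' (ev P a) (ev P a) ≠ 0 := mul_ne_zero ha
    (fun h => by rw [h] at hPa; simp at hPa)
  by_contra! hc
  have hbne : ∀ b, hf ε' (ev P b) (ev P b) ≠ 0 → b ≠ 0 := by
    rintro b hb rfl
    apply hb
    have : ev P 0 = 0 := by
      have := ev_smul H.hP 0 (0 : Fin n → ℂ)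
      rwa [smul_zero, zero_pow (by omega), zero_smul] at this
    rw [this, hf_zero_left]
  obtain ⟨G3, hG3, ⟨g1, hg1⟩, hGp3⟩ := perp_gen ε H.hε (by omega) hG2 (fun _ => a) hab 0
    (fun i => hf_zero_right _ _)
  have hDz : RLP (fun z : Fin n → ℂ => D ![z, x0 1]) := hD.comp _ fun x y => ⟨![y, 0], fun t => by
    ext k : 1
    fin_cases k <;> simp⟩
  have hDz0 : D ![x0 0, x0 1] ≠ 0 := by
    have : ![x0 0, x0 1] = x0 := by ext k : 1; fin_cases k <;> rfl
    rwa [this]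
  refine not_parallel H.hP (fun z x ψ1 ψ2 => ?_) _ _ (hDi x0 hx0)
  have hKx : ∀ z, RLP (fun x : Fin n → ℂ =>
      ψ1 (Dv P z x) * ψ2 (ev P z) - ψ2 (Dv P z x) * ψ1 (ev P z)) := fun z =>
    ((RLP.psiDx P ψ1 z).mul (RLP.const _)).sub ((RLP.psiDx P ψ2 z).mul (RLP.const _))
  have hKz : RLP (fun z : Fin n → ℂ =>
      ψ1 (Dv P z x) * ψ2 (ev P z) - ψ2 (Dv P z x) * ψ1 (ev P z)) :=
    ((RLP.psiDz P ψ1 x).mul (RLP.psiP P ψ2)).sub ((RLP.psiDz P ψ2 x).mul (RLP.psiP P ψ1))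
  by_contra hne
  obtain ⟨y, hy⟩ := hG3.mul_ne hDz hg1 hDz0
  obtain ⟨z, hz⟩ := (hG3.mul hDz).mul_ne hKz hy (sub_ne_zero.2 hne)
  have hz3 := right_ne_zero_of_mul hz
  obtain ⟨v, hv, hvp⟩ := hGp3 z (left_ne_zero_of_mul (left_ne_zero_of_mul hz))
  have hzi := hDi _ (right_ne_zero_of_mul (left_ne_zero_of_mul hz))
  simp only [Matrix.cons_val_zero, Matrix.cons_val_one] at hzi
  set b := v 0 with hb
  have hbb := right_ne_zero_of_mul hv
  have hb0 := hbne b hbb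
  have hzb : hf ε z b = 0 := hf_comm_zero ε H.hε (hvp 0).1
  obtain ⟨R, hR⟩ := exists_R H hb0
  obtain ⟨u, hu, hup⟩ := hGp b (left_ne_zero_of_mul hv)
  have hRz : MvPolynomial.eval z R = 0 := by
    by_contra hRz
    exact hc b hb0 R hR ⟨z, hzb, hRz⟩ (u 0) (u 1) (hup 0).1 (hup 1).1 (hDi u hu)
  obtain ⟨D', hD1', hD2', hD3'⟩ := pair_gen hzi
  have hh : RLP (fun x : Fin n → ℂ => hf ε' (ev P x) (ev P b)) :=
    RLP.hf ε' (RLP.ev (fun i => RLP.coord i) P) (fun i => RLP.const _)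
  obtain ⟨y, hy⟩ := hh.mul_ne hD1' hbb hD2'
  obtain ⟨y, hy⟩ := (hh.mul hD1').mul_ne (hKx z) hy hz3
  apply right_ne_zero_of_mul hy
  obtain ⟨α, β, hαβ⟩ := E0 hL (hD3' y (right_ne_zero_of_mul (left_ne_zero_of_mul hy)))
  have h1 := dv_hf (f := fp P (hfl ε' (ev P b))) (R := R) H.hε
    (fun z => by rw [fp_eval, hfl_apply]; exact hR z) hzb y
  rw [fp_dv, hfl_apply, hαβ, hf_add_left, hf_smul_left, hf_smul_left, H.orth _ _ hzb, hRz] at h1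
  have h2 : β = 0 := by
    have h3 : β * hf ε' (ev P y) (ev P b) = 0 := by linear_combination h1
    exact (mul_eq_zero.1 h3).resolve_right (left_ne_zero_of_mul (left_ne_zero_of_mul hy))
  rw [hαβ, h2]
  simp only [zero_smul, add_zero, map_smul, smul_eq_mul]
  ring

theorem degree_one (H : Dat d ε ε' P) (hL : LineP P) (hn : 3 < n) (hd : 1 ≤ d)
    (hcop : ∀ g : MvPolynomial (Fin n) ℂ, (∀ i, g ∣ P i) → g.totalDegree = 0) : d = 1 := by
  obtain ⟨b, hb, R, hR, ⟨w0, hw0, hRw0⟩, u1, u2, hu1, hu2, hui⟩ := good_b H hL hn hd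
  obtain ⟨w1, w2, hw1, hw2, hR1, hR2, hwi⟩ : ∃ w1 w2, hf ε w1 b = 0 ∧ hf ε w2 b = 0 ∧
      MvPolynomial.eval w1 R ≠ 0 ∧ MvPolynomial.eval w2 R ≠ 0 ∧
      LinearIndependent ℂ ![ev P w1, ev P w2] := by
    let V := LinearMap.ker (hfl ε b)
    have hc : ∀ (k : Fin 2) (i : Fin n), RLP (fun x : Fin 2 → V => (x k : Fin n → ℂ) i) :=
      fun k i => RLP.lin ((LinearMap.proj (R := ℂ) (φ := fun _ : Fin n => ℂ) i).comp
        (V.subtype.comp (LinearMap.proj (R := ℂ) (φ := fun _ : Fin 2 => V) k)))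
    have hli : LinearIndependent ℂ (fun k => (fun (k : Fin 2) (x : Fin 2 → V) => ev P (x k)) k
        ![⟨u1, hu1⟩, ⟨u2, hu2⟩]) := by
      have e : (fun k => (fun (k : Fin 2) (x : Fin 2 → V) => ev P (x k)) k
          ![⟨u1, hu1⟩, ⟨u2, hu2⟩]) = ![ev P u1, ev P u2] := by
        ext k : 1
        fin_cases k <;> rfl
      rwa [e]
    obtain ⟨D, hD1, hD2, hD3⟩ := RLP.semicont
      (x := fun (k : Fin 2) (x : Fin 2 → V) => ev P (x k))
      (fun k j => RLP.ev (hc k) P j) _ hli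
    have hRk : ∀ k : Fin 2, RLP (fun x : Fin 2 → V => MvPolynomial.eval (x k : Fin n → ℂ) R) :=
      fun k => RLP.eval (hc k) R
    have hm : MvPolynomial.eval w0 R * MvPolynomial.eval w0 R ≠ 0 := mul_ne_zero hRw0 hRw0
    obtain ⟨x, hx⟩ := ((hRk 0).mul (hRk 1)).mul_ne hD1 (a := fun _ => ⟨w0, hw0⟩) hm hD2
    refine ⟨x 0, x 1, (x 0).2, (x 1).2, left_ne_zero_of_mul (left_ne_zero_of_mul hx),
      right_ne_zero_of_mul (left_ne_zero_of_mul hx), ?_⟩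
    have := hD3 x (right_ne_zero_of_mul hx)
    have e : (fun k : Fin 2 => ev P (x k)) = ![ev P (x 0), ev P (x 1)] := by
      ext k : 1
      fin_cases k <;> rfl
    rwa [e] at this
  have hwi' : LinearIndependent ℂ ![ev P w2, ev P w1] := by
    rw [LinearIndependent.pair_iff] at hwi ⊢
    exact fun s t h => (hwi t s (by rw [add_comm]; exact h)).symm
  obtain ⟨φ, hφ1, hφ2⟩ : ∃ ψ : (Fin N → ℂ) →ₗ[ℂ] ℂ, ψ (ev P w1) ≠ 0 ∧ ψ (ev P w2) = 0 := by
    have : ev P w1 ∉ Submodule.span ℂ {ev P w2} := fun h => by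
      obtain ⟨c, hc⟩ := Submodule.mem_span_singleton.1 h
      have := (LinearIndependent.pair_iff.1 hwi') c (-1) (by rw [hc]; simp)
      simp at this
    obtain ⟨ψ, hψ, hk⟩ := Submodule.exists_le_ker_of_notMem this
    exact ⟨ψ, hψ, hk (Submodule.mem_span_singleton_self _)⟩
  have hfac : ∀ i, ∃ l : Fin n → ℂ, P i = R * ∑ j, MvPolynomial.C (l j) * MvPolynomial.X j := by
    intro i
    let ψ : (Fin N → ℂ) →ₗ[ℂ] ℂ := LinearMap.proj i
    let ψ2 : (Fin N → ℂ) →ₗ[ℂ] ℂ := (ψ (ev P w1) / φ (ev P w1)) • φ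
    let ψ1 : (Fin N → ℂ) →ₗ[ℂ] ℂ := ψ - ψ2
    have h1 : ψ1 (ev P w1) = 0 := by
      simp only [ψ1, ψ2, LinearMap.sub_apply, LinearMap.smul_apply, smul_eq_mul]
      rw [div_mul_cancel₀ _ hφ1, sub_self]
    have h2 : ψ2 (ev P w2) = 0 := by
      simp only [ψ2, LinearMap.smul_apply, hφ2, smul_zero]
    have e1 := E1 H hL hb hR hw1 hwi ψ1 h1
    have e2 := E1 H hL hb hR hw2 hwi' ψ2 h2
    refine ⟨fun j => MvPolynomial.eval w1 (MvPolynomial.pderiv j (fp P ψ1)) / MvPolynomial.eval w1 R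
      + MvPolynomial.eval w2 (MvPolynomial.pderiv j (fp P ψ2)) / MvPolynomial.eval w2 R, ?_⟩
    apply MvPolynomial.funext
    intro w
    have e3 : MvPolynomial.eval w (P i) = ψ1 (ev P w) + ψ2 (ev P w) := by
      simp [ψ1, ψ, ev]
    have e1 := e1 w
    have e2 := e2 w
    rw [← fp_dv] at e1 e2
    simp only [e3, map_mul, map_sum, MvPolynomial.eval_C, MvPolynomial.eval_X, add_mul,
      Finset.sum_add_distrib, mul_add]
    congr 1
    · rw [← mul_right_inj' hR1, ← e1, dv]
      simp only [Finset.mul_sum]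
      refine Finset.sum_congr rfl fun j _ => ?_
      field_simp
    · rw [← mul_right_inj' hR2, ← e2, dv]
      simp only [Finset.mul_sum]
      refine Finset.sum_congr rfl fun j _ => ?_
      field_simp
  have hdeg := hcop R (fun i => by
    obtain ⟨l, hl⟩ := hfac i
    exact ⟨_, hl⟩)
  rw [MvPolynomial.totalDegree_eq_zero_iff_eq_C] at hdeg
  obtain ⟨z, hz⟩ := H.ne
  obtain ⟨i, hi⟩ := Function.ne_iff.1 hz
  have hPi : P i ≠ 0 := fun h => hi (by simp [ev, h])
  refine (H.hP i).inj_right ?_ hPi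
  obtain ⟨l, hl⟩ := hfac i
  rw [hl, hdeg, ← zero_add 1]
  refine (MvPolynomial.isHomogeneous_C _ _).mul ?_
  refine MvPolynomial.IsHomogeneous.sum _ _ _ fun j _ => ?_
  rw [← zero_add 1]
  exact (MvPolynomial.isHomogeneous_C _ _).mul (MvPolynomial.isHomogeneous_X _ _)

end linsec

/-! ## Glue -/

def sg (a b : ℕ) : Fin (a + b) → ℂ := fun i => if (i : ℕ) < a then 1 else -1

theorem sg_sign (a b : ℕ) : IsSign (sg a b) := by
  intro i; unfold sg; split_ifs <;> simp

theorem hf_sg (a b : ℕ) (A A' : Fin a → ℂ) (B B' : Fin b → ℂ) :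
    hf (sg a b) (Fin.append A B) (Fin.append A' B')
      = ∑ i, A i * star (A' i) - ∑ j, B j * star (B' j) := by
  simp [hf, sg, Fin.sum_univ_add, sub_eq_add_neg]

theorem hf_sg_self (a b : ℕ) (A : Fin a → ℂ) (B : Fin b → ℂ) :
    hf (sg a b) (Fin.append A B) (Fin.append A B)
      = ((∑ i, ‖A i‖ ^ 2 - ∑ j, ‖B j‖ ^ 2 : ℝ) : ℂ) := by
  rw [hf_sg]; push_cast
  simp [Complex.mul_conj, Complex.normSq_eq_norm_sq]

theorem exists_append {a b : ℕ} (z : Fin (a + b) → ℂ) : ∃ A B, z = Fin.append A B :=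
  ⟨fun i => z (Fin.castAdd b i), fun j => z (Fin.natAdd a j), (Fin.append_castAdd_natAdd).symm⟩

theorem sum_sq_pos {a : ℕ} {A : Fin a → ℂ} (h : A ≠ 0) : 0 < ∑ i, ‖A i‖ ^ 2 := by
  obtain ⟨i, hi⟩ := Function.ne_iff.1 h
  refine Finset.sum_pos' (fun i _ => by positivity) ⟨i, Finset.mem_univ _, ?_⟩
  have : 0 < ‖A i‖ := norm_pos_iff.2 hi
  positivity

theorem exists_ker {a : ℕ} (ha : 2 ≤ a) (φ : (Fin a → ℂ) →ₗ[ℂ] ℂ) : ∃ A, A ≠ 0 ∧ φ A = 0 := by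
  have h := LinearMap.ker_ne_bot_of_finrank_lt (f := φ) (by simp; omega)
  obtain ⟨A, h1, h2⟩ := (Submodule.ne_bot_iff _).1 h
  exact ⟨A, h2, h1⟩

theorem sg_hpos {a b : ℕ} (ha : 2 ≤ a) (z : Fin (a + b) → ℂ) :
    ∃ w, hf (sg a b) z w = 0 ∧ 0 < (hf (sg a b) w w).re := by
  obtain ⟨A, B, rfl⟩ := exists_append z
  obtain ⟨A', h1, h2⟩ := exists_ker ha (∑ i, (star (A i)) • LinearMap.proj i)
  refine ⟨Fin.append A' 0, hf_comm_zero _ (sg_sign _ _) ?_, ?_⟩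
  · rw [hf_sg]; simpa [mul_comm] using h2
  · rw [hf_sg_self, Complex.ofReal_re]; simpa using sum_sq_pos h1

theorem sg_hneg {a b : ℕ} (hb : 2 ≤ b) (z : Fin (a + b) → ℂ) :
    ∃ w, hf (sg a b) z w = 0 ∧ (hf (sg a b) w w).re < 0 := by
  obtain ⟨A, B, rfl⟩ := exists_append z
  obtain ⟨A', h1, h2⟩ := exists_ker hb (∑ i, (star (B i)) • LinearMap.proj i)
  refine ⟨Fin.append 0 A', hf_comm_zero _ (sg_sign _ _) ?_, ?_⟩
  · rw [hf_sg]; simpa [mul_comm] using h2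
  · rw [hf_sg_self, Complex.ofReal_re]; simpa using sum_sq_pos h1

theorem ev_append {n a b : ℕ} (P1 : Fin a → MvPolynomial (Fin n) ℂ)
    (P2 : Fin b → MvPolynomial (Fin n) ℂ) (z : Fin n → ℂ) :
    ev (Fin.append P1 P2) z = Fin.append (fun i => MvPolynomial.eval z (P1 i))
      (fun j => MvPolynomial.eval z (P2 j)) := by
  ext i
  refine Fin.addCases (fun i => ?_) (fun i => ?_) i <;> simp [ev]

theorem append_eq_zero {a b : ℕ} {A : Fin a → ℂ} {B : Fin b → ℂ} :
    Fin.append A B = 0 ↔ (∀ i, A i = 0) ∧ ∀ j, B j = 0 := by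
  constructor
  · intro h
    exact ⟨fun i => by simpa using congrFun h (Fin.castAdd b i),
      fun i => by simpa using congrFun h (Fin.natAdd a i)⟩
  · rintro ⟨h1, h2⟩
    ext i
    refine Fin.addCases (fun i => ?_) (fun i => ?_) i <;> simp [h1, h2]

theorem mk_dat {q p q' p' d : ℕ} (h2q : 2 ≤ q) (h2p : 2 ≤ p)
    {P1 : Fin q' → MvPolynomial (Fin (q + p)) ℂ}
    {P2 : Fin p' → MvPolynomial (Fin (q + p)) ℂ}
    (hrep : IsRatProperRep q p q' p' d P1 P2) :
    Dat d (sg q p) (sg q' p') (Fin.append P1 P2) := by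
  obtain ⟨hd, hP1, hP2, hne, -, hpos, hnull⟩ := hrep
  have hP : ∀ i, (Fin.append P1 P2 i).IsHomogeneous d := by
    intro i
    refine Fin.addCases (fun i => ?_) (fun i => ?_) i <;> simp [hP1, hP2]
  have hnull' : ∀ z, hf (sg q p) z z = 0 →
      hf (sg q' p') (ev (Fin.append P1 P2) z) (ev (Fin.append P1 P2) z) = 0 := by
    intro z hz
    by_cases h0 : ev (Fin.append P1 P2) z = 0
    · rw [h0, hf_zero_left]
    obtain ⟨A, B, rfl⟩ := exists_append z
    rw [hf_sg_self] at hz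
    rw [ev_append, hf_sg_self]
    rw [ev_append, append_eq_zero] at h0
    have := hnull A B ?_ (by have := Complex.ofReal_eq_zero.1 hz; linarith) h0
    · rw [this]; simp
    · rintro ⟨rfl, rfl⟩
      apply h0
      have hz0 : Fin.append (0 : Fin q → ℂ) (0 : Fin p → ℂ) = 0 := append_eq_zero.2 (by simp)
      have := ev_smul hP 0 0
      rw [zero_pow (by omega), zero_smul, zero_smul, ev_append, append_eq_zero] at this
      rw [hz0]; exact this
  refine ⟨sg_sign _ _, sg_sign _ _, hP, ?_, ?_, ?_, ?_⟩
  · intro z w hzw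
    exact orth (sg_sign _ _) hP hnull' (sg_hneg h2p) (sg_hpos h2q) hzw
  · intro z hz h0
    obtain ⟨A, B, rfl⟩ := exists_append z
    rw [hf_sg_self, Complex.ofReal_re] at hz
    rw [ev_append, hf_sg_self, Complex.ofReal_re]
    rw [ev_append, Ne, append_eq_zero] at h0
    have := hpos A B (by linarith) h0
    linarith
  · obtain ⟨w, -, h⟩ := sg_hpos (b := p) h2q 0
    exact ⟨w, h⟩
  · by_contra hcon
    push Not at hcon
    apply hne
    constructor
    · intro i
      refine MvPolynomial.funext fun z => ?_
      have := hcon z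
      rw [ev_append, append_eq_zero] at this
      simpa using this.1 i
    · intro i
      refine MvPolynomial.funext fun z => ?_
      have := hcon z
      rw [ev_append, append_eq_zero] at this
      simpa using this.2 i

theorem mk_cop {q p q' p' d : ℕ}
    {P1 : Fin q' → MvPolynomial (Fin (q + p)) ℂ}
    {P2 : Fin p' → MvPolynomial (Fin (q + p)) ℂ}
    (hrep : IsRatProperRep q p q' p' d P1 P2) (g : MvPolynomial (Fin (q + p)) ℂ)
    (hg : ∀ i, g ∣ Fin.append P1 P2 i) : g.totalDegree = 0 := by
  obtain ⟨hd, hP1, hP2, hne, hc, -⟩ := hrep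
  exact hc g (fun i => by simpa using hg (Fin.castAdd p' i))
    (fun i => by simpa using hg (Fin.natAdd q' i))

/-! ## The fibral-image-preserving condition -/

theorem dot_cs {a : ℕ} (x y : Fin a → ℂ) :
    ‖x ⬝ᵥ y‖ ^ 2 ≤ (∑ i, ‖x i‖ ^ 2) * ∑ i, ‖y i‖ ^ 2 := by
  have h1 : ‖x ⬝ᵥ y‖ ≤ ∑ i, ‖x i‖ * ‖y i‖ := by
    refine (norm_sum_le _ _).trans_eq ?_
    simp
  calc ‖x ⬝ᵥ y‖ ^ 2 ≤ (∑ i, ‖x i‖ * ‖y i‖) ^ 2 := by gcongr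
    _ ≤ _ := Finset.sum_mul_sq_le_sq_mul_sq _ _ _

theorem star_dot_self {a : ℕ} (x : Fin a → ℂ) :
    star x ⬝ᵥ x = ((∑ i, ‖x i‖ ^ 2 : ℝ) : ℂ) := by
  simp [dotProduct, ← Complex.normSq_eq_conj_mul_self, Complex.normSq_eq_norm_sq]

theorem posdef_form {a b : ℕ} (Z : Matrix (Fin a) (Fin b) ℂ) (x : Fin b → ℂ) :
    star x ⬝ᵥ ((1 - Zᴴ * Z) *ᵥ x)
      = ((∑ j, ‖x j‖ ^ 2 - ∑ i, ‖(Z *ᵥ x) i‖ ^ 2 : ℝ) : ℂ) := by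
  rw [Matrix.sub_mulVec, dotProduct_sub, Matrix.one_mulVec, star_dot_self,
    ← Matrix.mulVec_mulVec, Matrix.dotProduct_mulVec, ← Matrix.star_mulVec, star_dot_self]
  push_cast; rfl

theorem mem_dom {a b : ℕ} (Z : Matrix (Fin a) (Fin b) ℂ) (h : ∑ i, ∑ j, ‖Z i j‖ ^ 2 < 1) :
    Z ∈ typeIDomain a b := by
  refine Matrix.PosDef.of_dotProduct_mulVec_pos ?_ fun x hx => ?_
  · exact (Matrix.isHermitian_one).sub (Matrix.isHermitian_conjTranspose_mul_self Z)
  · rw [posdef_form]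
    have h0 := sum_sq_pos hx
    have h1 : ∑ i, ‖(Z *ᵥ x) i‖ ^ 2 ≤ (∑ i, ∑ j, ‖Z i j‖ ^ 2) * ∑ j, ‖x j‖ ^ 2 := by
      rw [Finset.sum_mul]
      exact Finset.sum_le_sum fun i _ => dot_cs _ _
    have : 0 < ∑ j, ‖x j‖ ^ 2 - ∑ i, ‖(Z *ᵥ x) i‖ ^ 2 := by nlinarith
    exact_mod_cast this

theorem dom_contract {a b : ℕ} {W : Matrix (Fin a) (Fin b) ℂ} (hW : W ∈ typeIDomain a b)
    {C : Fin a → ℂ} (hC : C ≠ 0) : ∑ j, ‖(C ᵥ* W) j‖ ^ 2 < ∑ i, ‖C i‖ ^ 2 := by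
  have hC0 := sum_sq_pos hC
  by_cases hy : C ᵥ* W = 0
  · rw [hy]; simpa using hC0
  set y := C ᵥ* W with hyd
  have hy0 := sum_sq_pos hy
  have hx : star y ≠ 0 := by simpa using hy
  have h1 := Matrix.PosDef.dotProduct_mulVec_pos hW hx
  rw [posdef_form] at h1
  have h1 : 0 < ∑ j, ‖(star y) j‖ ^ 2 - ∑ i, ‖(W *ᵥ star y) i‖ ^ 2 := by exact_mod_cast h1
  simp only [Pi.star_apply, norm_star] at h1
  have h2 := dot_cs C (W *ᵥ star y)
  rw [Matrix.dotProduct_mulVec, ← hyd, dotProduct_comm, star_dot_self, Complex.norm_real,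
    Real.norm_eq_abs, sq_abs] at h2
  nlinarith

theorem mk_fip {q p q' p' : ℕ}
    (P1 : Fin q' → MvPolynomial (Fin (q + p)) ℂ)
    (P2 : Fin p' → MvPolynomial (Fin (q + p)) ℂ)
    (hfip : ∀ Z ∈ typeIDomain q p, ∃ W ∈ typeIDomain q' p',
      ∀ A : Fin q → ℂ,
        ¬ ((∀ i, MvPolynomial.eval (Fin.append A (A ᵥ* Z)) (P1 i) = 0) ∧
           (∀ j, MvPolynomial.eval (Fin.append A (A ᵥ* Z)) (P2 j) = 0)) →
        (fun i => MvPolynomial.eval (Fin.append A (A ᵥ* Z)) (P1 i)) ᵥ* W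
          = fun j => MvPolynomial.eval (Fin.append A (A ᵥ* Z)) (P2 j)) :
    ∃ O, FipDat q q' (sg q' p') (Fin.append P1 P2) O := by
  let Am : (Fin q → Fin (q + p) → ℂ) → Matrix (Fin q) (Fin q) ℂ :=
    fun v => Matrix.of fun i j => v i (Fin.castAdd p j)
  let Bm : (Fin q → Fin (q + p) → ℂ) → Matrix (Fin q) (Fin p) ℂ :=
    fun v => Matrix.of fun i j => v i (Fin.natAdd q j)
  have cA : Continuous Am := by
    refine continuous_matrix fun i j => ?_
    simp only [Am, Matrix.of_apply]; fun_prop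
  have cB : Continuous Bm := by
    refine continuous_matrix fun i j => ?_
    simp only [Bm, Matrix.of_apply]; fun_prop
  refine ⟨{v | ∑ i, ∑ j, ‖((Am v).adjugate * Bm v) i j‖ ^ 2 < ‖(Am v).det‖ ^ 2}, ?_, ?_, ?_⟩
  · refine isOpen_lt ?_ ?_
    · refine continuous_finsetSum _ fun i _ => continuous_finsetSum _ fun j _ => ?_
      exact (((cA.matrix_adjugate.matrix_mul cB).matrix_elem i j).norm).pow 2
    · exact (cA.matrix_det.norm).pow 2
  · refine ⟨fun i => Fin.append ((1 : Matrix (Fin q) (Fin q) ℂ) i) 0, ?_⟩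
    have hA : Am (fun i => Fin.append ((1 : Matrix (Fin q) (Fin q) ℂ) i) 0) = 1 := by
      ext i j; simp [Am]
    have hB : Bm (fun i => Fin.append ((1 : Matrix (Fin q) (Fin q) ℂ) i) 0) = 0 := by
      ext i j; simp [Bm]
    simp only [Set.mem_ofPred_eq]
    rw [hA, hB]; simp
  · intro v hv
    have hv : ∑ i, ∑ j, ‖((Am v).adjugate * Bm v) i j‖ ^ 2 < ‖(Am v).det‖ ^ 2 := hv
    have hdet0 : 0 < ‖(Am v).det‖ ^ 2 := lt_of_le_of_lt (by positivity) hv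
    have hdet : (Am v).det ≠ 0 := by
      intro h; rw [h] at hdet0; simp at hdet0
    set Z : Matrix (Fin q) (Fin p) ℂ := (Am v).det⁻¹ • ((Am v).adjugate * Bm v) with hZ
    have hZd : Z ∈ typeIDomain q p := by
      apply mem_dom
      simp only [hZ, Matrix.smul_apply, smul_eq_mul, norm_mul, norm_inv, mul_pow, ← Finset.mul_sum]
      rw [inv_pow, inv_mul_lt_iff₀ hdet0, mul_one]; exact hv
    have hAZ : Am v * Z = Bm v := by
      rw [hZ, Matrix.mul_smul, ← Matrix.mul_assoc, Matrix.mul_adjugate, Matrix.smul_mul,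
        Matrix.one_mul, smul_smul, inv_mul_cancel₀ hdet, one_smul]
    obtain ⟨W, hW, hWP⟩ := hfip Z hZd
    let Φ : (Fin q' → ℂ) →ₗ[ℂ] (Fin (q' + p') → ℂ) :=
      { toFun := fun C => Fin.append C (C ᵥ* W)
        map_add' := fun x y => by
          ext i
          refine Fin.addCases (fun i => ?_) (fun i => ?_) i <;> simp [Matrix.add_vecMul]
        map_smul' := fun c x => by
          ext i
          refine Fin.addCases (fun i => ?_) (fun i => ?_) i <;> simp [Matrix.smul_vecMul] }
    refine ⟨LinearMap.range Φ, ?_, ?_, ?_⟩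
    · simpa using LinearMap.finrank_range_le Φ
    · rintro _ ⟨C, rfl⟩ h
      by_cases hC : C = 0
      · rw [hC, map_zero]
      have h : hf (sg q' p') (Fin.append C (C ᵥ* W)) (Fin.append C (C ᵥ* W)) = 0 := h
      rw [hf_sg_self] at h
      have h := Complex.ofReal_eq_zero.1 h
      have := dom_contract hW hC
      linarith
    · intro c
      have hs : ∑ i, c i • v i = Fin.append (c ᵥ* Am v) ((c ᵥ* Am v) ᵥ* Z) := by
        rw [Matrix.vecMul_vecMul, hAZ]
        ext k
        refine Fin.addCases (fun i => ?_) (fun i => ?_) k <;>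
          simp [Matrix.vecMul, dotProduct, Am, Bm]
      rw [hs, ev_append]
      by_cases h : ((∀ i, MvPolynomial.eval (Fin.append (c ᵥ* Am v) ((c ᵥ* Am v) ᵥ* Z)) (P1 i) = 0) ∧
           (∀ j, MvPolynomial.eval (Fin.append (c ᵥ* Am v) ((c ᵥ* Am v) ᵥ* Z)) (P2 j) = 0))
      · rw [append_eq_zero.2 h]; exact Submodule.zero_mem _
      · rw [← hWP _ h]; exact ⟨_, rfl⟩

/-! ## Extension of pseudo-orthonormal families -/

section wittsec
variable {N : ℕ} {ε : Fin N → ℂ}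

theorem witt_step (hε : IsSign ε) (t : Fin N → Fin N → ℂ) (I : Finset (Fin N))
    (ht : ∀ i ∈ I, ∀ k ∈ I, hf ε (t i) (t k) = if i = k then ε i else 0)
    {j : Fin N} (hj : j ∉ I) :
    ∃ u, (∀ i ∈ I, hf ε u (t i) = 0) ∧ hf ε u u = ε j := by
  classical
  have hη0 : ε j ≠ 0 := by rcases hε j with h | h <;> simp [h]
  have hne : ∀ l, ε l = -ε j → ε l ≠ ε j := by
    intro l h1 h2
    rw [h2] at h1
    exact hη0 (self_eq_neg.1 h1)
  let Φ : (Fin N → ℂ) →ₗ[ℂ] (Fin N → ℂ) := LinearMap.pi fun l =>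
    if l ∈ I ∧ ε l = ε j then hfl ε (t l) else if ε l = -ε j then LinearMap.proj l else 0
  have hΦj : ∀ y, Φ y j = 0 := by
    intro y
    have : ε j ≠ -ε j := fun h => hne j h rfl
    simp [Φ, hj, this]
  have hker : LinearMap.ker Φ ≠ ⊥ := by
    intro h
    have hs := LinearMap.injective_iff_surjective.1 (LinearMap.ker_eq_bot.1 h)
    obtain ⟨y, hy⟩ := hs (Pi.single j 1)
    have := hΦj y
    rw [hy] at this
    simp at this
  obtain ⟨y, hy, hy0⟩ := (Submodule.ne_bot_iff _).1 hker
  have hyl : ∀ l, Φ y l = 0 := fun l => congrFun (LinearMap.mem_ker.1 hy) l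
  have hy1 : ∀ l, ε l = -ε j → y l = 0 := by
    intro l hl
    have := hyl l
    have h' : ¬ (l ∈ I ∧ ε l = ε j) := fun h => hne l hl h.2
    simpa only [Φ, LinearMap.pi_apply, if_neg h', if_pos hl, LinearMap.proj_apply] using this
  have hy2 : ∀ l ∈ I, ε l = ε j → hf ε y (t l) = 0 := by
    intro l hl h
    have := hyl l
    simpa [Φ, hl, h] using this
  have hyy : hf ε y y = ε j * ((∑ i, ‖y i‖ ^ 2 : ℝ) : ℂ) := by
    push_cast
    rw [hf, Finset.mul_sum]
    refine Finset.sum_congr rfl fun l _ => ?_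
    have hn : y l * star (y l) = (‖y l‖ : ℂ) ^ 2 := by
      simp [Complex.mul_conj, Complex.normSq_eq_norm_sq]
    rw [hn]
    have : ε l = ε j ∨ ε l = -ε j := by
      rcases hε l with h | h <;> rcases hε j with h' | h' <;> simp [h, h']
    rcases this with h | h
    · rw [h]
    · simp [hy1 l h]
  let J := I.filter fun i => ε i = -ε j
  let x := ∑ i ∈ J, (ε i * hf ε y (t i)) • t i
  let u := y - x
  have hxk : ∀ k ∈ I, hf ε x (t k) = if ε k = -ε j then hf ε y (t k) else 0 := by
    intro k hk
    have h1 : hf ε x (t k) = ∑ i ∈ J, if i = k then ε i * ε i * hf ε y (t i) else 0 := by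
      rw [hf_sum_left]
      refine Finset.sum_congr rfl fun i hi => ?_
      rw [hf_smul_left, ht i (Finset.mem_filter.1 hi).1 k hk]
      split_ifs <;> ring
    rw [h1, Finset.sum_ite_eq', hε.mul_self, one_mul]
    simp [J, hk]
  have huk : ∀ k ∈ I, hf ε u (t k) = 0 := by
    intro k hk
    rw [hf_sub_left, hxk k hk]
    split_ifs with h
    · ring
    · have : ε k = ε j := by
        rcases hε k with h1 | h1 <;> rcases hε j with h' | h' <;> simp_all
      rw [hy2 k hk this]; ring
  have hxu : hf ε x u = 0 := by
    rw [hf_sum_left]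
    refine Finset.sum_eq_zero fun i hi => ?_
    rw [hf_smul_left, hf_comm_zero ε hε (huk i (Finset.mem_filter.1 hi).1), mul_zero]
  have hxy : hf ε x y = -ε j * ((∑ i ∈ J, ‖hf ε y (t i)‖ ^ 2 : ℝ) : ℂ) := by
    push_cast
    rw [hf_sum_left, Finset.mul_sum]
    refine Finset.sum_congr rfl fun i hi => ?_
    rw [hf_smul_left, ← hf_conj ε hε y (t i), (Finset.mem_filter.1 hi).2, mul_assoc]
    simp [Complex.mul_conj, Complex.normSq_eq_norm_sq]
  set s : ℝ := ∑ i, ‖y i‖ ^ 2 + ∑ i ∈ J, ‖hf ε y (t i)‖ ^ 2 with hs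
  have hs0 : 0 < s := by
    have := sum_sq_pos hy0
    have : 0 ≤ ∑ i ∈ J, ‖hf ε y (t i)‖ ^ 2 := by positivity
    linarith
  have huy : hf ε u y = ε j * (s : ℂ) := by
    rw [hf_sub_left, hyy, hxy, hs]; push_cast; ring
  have huu : hf ε u u = ε j * (s : ℂ) := by
    have : hf ε u u = hf ε y u := by
      rw [show hf ε u u = hf ε y u - hf ε x u from hf_sub_left ε y x u, hxu, sub_zero]
    rw [this, ← hf_conj ε hε, huy]
    simp only [star_mul', hε.star]
    simp
  have hsq : ((√s : ℝ) : ℂ) * ((√s : ℝ) : ℂ) = (s : ℂ) := by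
    rw [← Complex.ofReal_mul, Real.mul_self_sqrt hs0.le]
  have hs1 : ((√s : ℝ) : ℂ) ≠ 0 := by
    exact_mod_cast (Real.sqrt_pos.2 hs0).ne'
  refine ⟨((√s : ℝ) : ℂ)⁻¹ • u, fun i hi => ?_, ?_⟩
  · rw [hf_smul_left, huk i hi, mul_zero]
  · rw [hf_smul_left, hf_smul_right, huu, ← hsq]
    have : star (((√s : ℝ) : ℂ)⁻¹) = ((√s : ℝ) : ℂ)⁻¹ := by simp
    rw [this]
    field_simp

theorem witt (hε : IsSign ε) (t : Fin N → Fin N → ℂ) (I : Finset (Fin N))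
    (ht : ∀ i ∈ I, ∀ k ∈ I, hf ε (t i) (t k) = if i = k then ε i else 0) :
    ∃ M : Fin N → Fin N → ℂ, (∀ i ∈ I, M i = t i) ∧
      ∀ i k, hf ε (M i) (M k) = if i = k then ε i else 0 := by
  classical
  have key : ∀ J : Finset (Fin N), ∃ M : Fin N → Fin N → ℂ, (∀ i ∈ I, M i = t i) ∧
      ∀ i ∈ I ∪ J, ∀ k ∈ I ∪ J, hf ε (M i) (M k) = if i = k then ε i else 0 := by
    intro J
    induction J using Finset.induction_on with
    | empty => exact ⟨t, fun _ _ => rfl, by simpa using ht⟩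
    | insert j J hj ih =>
      obtain ⟨M, h1, h2⟩ := ih
      by_cases hjI : j ∈ I ∪ J
      · refine ⟨M, h1, ?_⟩
        have : I ∪ insert j J = I ∪ J := by
          rw [Finset.union_insert, Finset.insert_eq_of_mem hjI]
        rw [this]; exact h2
      · obtain ⟨u, hu1, hu2⟩ := witt_step hε M (I ∪ J) h2 hjI
        refine ⟨Function.update M j u, ?_, ?_⟩
        · intro i hi
          rw [Function.update_of_ne, h1 i hi]
          rintro rfl
          exact hjI (Finset.mem_union_left _ hi)
        · rw [Finset.union_insert]
          intro i hi0 k hk0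
          rcases Finset.mem_insert.1 hi0 with rfl | hi
          · rcases Finset.mem_insert.1 hk0 with rfl | hk
            · simp [hu2]
            · have hne : k ≠ i := fun h => hjI (h ▸ hk)
              rw [Function.update_self, Function.update_of_ne hne, hu1 k hk, if_neg hne.symm]
          · have hne : i ≠ j := fun h => hjI (h ▸ hi)
            rcases Finset.mem_insert.1 hk0 with rfl | hk
            · rw [Function.update_self, Function.update_of_ne hne,
                hf_comm_zero ε hε (hu1 i hi), if_neg hne]
            · have hne' : k ≠ j := fun h => hjI (h ▸ hk)
              rw [Function.update_of_ne hne, Function.update_of_ne hne', h2 i hi k hk]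
  obtain ⟨M, h1, h2⟩ := key Finset.univ
  exact ⟨M, h1, fun i k => h2 i (by simp) k (by simp)⟩

end wittsec

/-! ## The linear case -/

theorem eval_deg_one {n : ℕ} {f : MvPolynomial (Fin n) ℂ} (h : f.IsHomogeneous 1)
    (z : Fin n → ℂ) :
    MvPolynomial.eval z f = ∑ i, z i * MvPolynomial.eval (Pi.single i 1) f := by
  have h' : f ∈ MvPolynomial.homogeneousSubmodule (Fin n) ℂ 1 := h
  rw [MvPolynomial.homogeneousSubmodule_one_eq_span_X] at h'
  clear h
  induction h' using Submodule.span_induction with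
  | mem x hx =>
    obtain ⟨j, rfl⟩ := hx
    simp [Pi.single_apply]
  | zero => simp
  | add x y hx hy h1 h2 =>
    simp only [map_add, mul_add, Finset.sum_add_distrib, h1, h2]
  | smul a x hx h1 =>
    simp only [MvPolynomial.smul_eval, h1, Finset.mul_sum]
    exact Finset.sum_congr rfl fun i _ => by ring

theorem ev_deg_one {n N : ℕ} {P : Fin N → MvPolynomial (Fin n) ℂ}
    (hP : ∀ i, (P i).IsHomogeneous 1) (z : Fin n → ℂ) :
    ev P z = ∑ i, z i • ev P (Pi.single i 1) := by
  ext k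
  simp only [ev, Finset.sum_apply, Pi.smul_apply, smul_eq_mul]
  exact eval_deg_one (hP k) z

theorem hf_single {n : ℕ} (ε : Fin n → ℂ) (i j : Fin n) :
    hf ε (Pi.single i 1) (Pi.single j 1) = if i = j then ε i else 0 := by
  classical
  simp only [hf, Pi.single_apply]
  rw [Finset.sum_eq_single i]
  · by_cases h : i = j <;> simp [h]
  · intro b _ hb; simp [hb]
  · simp

/-- the images of the basis vectors are pseudo-orthonormal up to one positive scale -/
theorem lin_scale {n N : ℕ} {ε : Fin n → ℂ} {ε' : Fin N → ℂ} {P : Fin N → MvPolynomial (Fin n) ℂ}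
    (H : Dat 1 ε ε' P) {i0 j0 : Fin n} (hi0 : ε i0 = 1) (hj0 : ε j0 = -1) :
    ∃ s : ℝ, 0 < s ∧ ∀ i j, hf ε' (ev P (Pi.single i 1)) (ev P (Pi.single j 1))
      = if i = j then ε i * (s : ℂ) else 0 := by
  classical
  set g : Fin n → Fin N → ℂ := fun i => ev P (Pi.single i 1) with hg
  have horth : ∀ i j, i ≠ j → hf ε' (g i) (g j) = 0 := by
    intro i j hij
    apply H.orth
    rw [hf_single, if_neg hij]
  have hev : ∀ i j, ev P (Pi.single i 1 + Pi.single j 1) = g i + g j := by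
    intro i j
    rw [ev_deg_one H.hP]
    simp [Pi.single_apply, add_smul, Finset.sum_add_distrib, hg]
  have hnull : ∀ i j, ε i = 1 → ε j = -1 → hf ε' (g i) (g i) + hf ε' (g j) (g j) = 0 := by
    intro i j hi hj
    have hij : i ≠ j := by
      rintro rfl
      rw [hi] at hj
      norm_num at hj
    have h1 := H.orth (Pi.single i 1 + Pi.single j 1) (Pi.single i 1 + Pi.single j 1) (by
      simp [hf_add_left, hf_add_right, hf_single, hij, hij.symm, hi, hj])
    rw [hev] at h1
    simpa [hf_add_left, hf_add_right, horth i j hij, horth j i hij.symm] using h1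
  set c := hf ε' (g i0) (g i0) with hc
  have hall : ∀ i, hf ε' (g i) (g i) = ε i * c := by
    intro i
    have h0 := hnull i0 j0 hi0 hj0
    rcases H.hε i with h | h
    · have h1 := hnull i j0 h hj0
      rw [h]; linear_combination h1 - h0
    · have h1 := hnull i0 i hi0 h
      rw [h]; linear_combination h1
  have hcr : c = (c.re : ℂ) := hf_self_im ε' H.hε' (g i0)
  have hfull : ∀ z, hf ε' (ev P z) (ev P z) = c * hf ε z z := by
    intro z
    have hz : ∀ i, hf ε' (ev P z) (g i) = z i * (ε i * c) := by
      intro i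
      rw [ev_deg_one H.hP, hf_sum_left, Finset.sum_eq_single i]
      · rw [hf_smul_left]; exact congrArg _ (hall i)
      · intro b _ hb
        rw [hf_smul_left]; rw [show hf ε' (ev P (Pi.single b 1)) (g i) = 0 from horth b i hb, mul_zero]
      · simp
    have hz' : ∀ i, hf ε' (g i) (ev P z) = star (z i) * (ε i * c) := by
      intro i
      rw [← hf_conj ε' H.hε', hz, star_mul', star_mul', H.hε.star, hcr]
      simp
    conv_lhs => rw [show ev P z = ∑ i, z i • g i from ev_deg_one H.hP z]
    rw [hf_sum_left]
    rw [hf, Finset.mul_sum]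
    refine Finset.sum_congr rfl fun i _ => ?_
    rw [hf_smul_left, ← ev_deg_one H.hP z, hz' i]
    ring
  obtain ⟨w0, hw0⟩ := H.posex
  obtain ⟨a, -, ha1, ha2⟩ := H.posgen (G := fun _ => 1) (RLP.const 1) (w0 := w0) one_ne_zero
  rw [hfull a, hf_self_im ε H.hε a, hcr, ← Complex.ofReal_mul, Complex.ofReal_re] at ha2
  refine ⟨c.re, pos_of_mul_pos_left ha2 ha1.le, ?_⟩
  intro i j
  split_ifs with h
  · subst h; rw [← hcr]; exact hall i
  · exact horth i j h

/-! ## Assembly -/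

def kap {q p q' p' : ℕ} (hq : q ≤ q') (hp : p ≤ p') (i : Fin (q + p)) : Fin (q' + p') :=
  if h : (i : ℕ) < q then ⟨i, by omega⟩ else ⟨(i : ℕ) - q + q', by omega⟩

theorem kap_inj {q p q' p' : ℕ} (hq : q ≤ q') (hp : p ≤ p') :
    Function.Injective (kap hq hp) := by
  intro i j h
  unfold kap at h
  split_ifs at h <;> simp only [Fin.mk.injEq] at h <;> ext <;> omega

theorem sg_kap {q p q' p' : ℕ} (hq : q ≤ q') (hp : p ≤ p') (i : Fin (q + p)) :
    sg q' p' (kap hq hp i) = sg q p i := by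
  unfold sg kap
  by_cases h : (i : ℕ) < q
  · have : (i : ℕ) < q' := by omega
    simp [h, this]
  · simp [h]

theorem pad_kap {q p q' p' : ℕ} (hq : q ≤ q') (hp : p ≤ p') (z : Fin (q + p) → ℂ)
    (i : Fin (q + p)) : padSig q p q' p' z (kap hq hp i) = z i := by
  unfold padSig kap
  by_cases h : (i : ℕ) < q
  · simp [h]
  · have h1 : ¬ ((i : ℕ) - q + q' < q) := by omega
    have h2 : q' ≤ (i : ℕ) - q + q' ∧ (i : ℕ) - q + q' < q' + p := by omega
    simp only [h, dif_neg, not_false_eq_true, h1, h2, and_self, dif_pos]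
    congr 1
    ext
    simp only []
    omega

theorem pad_zero {q p q' p' : ℕ} (hq : q ≤ q') (hp : p ≤ p') (z : Fin (q + p) → ℂ)
    (l : Fin (q' + p')) (hl : l ∉ Set.range (kap hq hp)) : padSig q p q' p' z l = 0 := by
  unfold padSig
  split_ifs with h1 h2
  · exfalso
    apply hl
    refine ⟨⟨l, by omega⟩, ?_⟩
    simp [kap, h1]
  · exfalso
    apply hl
    refine ⟨⟨(l : ℕ) - q' + q, by omega⟩, ?_⟩
    ext
    simp [kap]
    omega
  · rfl

theorem sig_mul {a b : ℕ} (M : Matrix (Fin (a + b)) (Fin (a + b)) ℂ) (i k : Fin (a + b)) :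
    (M * sigMatrix a b * Mᴴ) i k = hf (sg a b) (M i) (M k) := by
  have : sigMatrix a b = Matrix.diagonal (sg a b) := rfl
  rw [this, Matrix.mul_apply]
  simp only [Matrix.mul_diagonal, Matrix.conjTranspose_apply, hf]
  exact Finset.sum_congr rfl fun j _ => by ring

theorem sig_sq (a b : ℕ) : sigMatrix a b * sigMatrix a b = 1 := by
  have : sigMatrix a b = Matrix.diagonal (sg a b) := rfl
  rw [this, Matrix.diagonal_mul_diagonal, ← Matrix.diagonal_one]
  congr 1
  ext i
  exact (sg_sign a b).mul_self i

theorem final_lin {q p q' p' : ℕ} (h2q : 2 ≤ q) (h2p : 2 ≤ p) (hq : q ≤ q') (hp : p ≤ p')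
    {P : Fin (q' + p') → MvPolynomial (Fin (q + p)) ℂ}
    (H : Dat 1 (sg q p) (sg q' p') P) :
    ∃ (M : Matrix (Fin (q' + p')) (Fin (q' + p')) ℂ) (c : ℂ),
      c ≠ 0 ∧ IsUnit M ∧
      M * sigMatrix q' p' * Mᴴ = sigMatrix q' p' ∧
      ∀ z : Fin (q + p) → ℂ, ev P z = c • ((padSig q p q' p' z) ᵥ* M) := by
  classical
  obtain ⟨s, hs0, hs⟩ := lin_scale H (i0 := ⟨0, by omega⟩) (j0 := ⟨q, by omega⟩)
    (by simp [sg]; omega) (by simp [sg])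
  have hsq : ((√s : ℝ) : ℂ) * ((√s : ℝ) : ℂ) = (s : ℂ) := by
    rw [← Complex.ofReal_mul, Real.mul_self_sqrt hs0.le]
  set r : ℂ := ((√s : ℝ) : ℂ) with hr
  have hr0 : r ≠ 0 := by
    rw [hr]; exact_mod_cast (Real.sqrt_pos.2 hs0).ne'
  have hrs : star (r⁻¹) = r⁻¹ := by simp [hr]
  let t : Fin (q' + p') → Fin (q' + p') → ℂ :=
    Function.extend (kap hq hp) (fun i => r⁻¹ • ev P (Pi.single i 1)) 0
  have htk : ∀ i, t (kap hq hp i) = r⁻¹ • ev P (Pi.single i 1) :=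
    fun i => (kap_inj hq hp).extend_apply _ _ i
  obtain ⟨M, hM1, hM2⟩ := witt (sg_sign q' p') t (Finset.univ.image (kap hq hp)) (by
    intro i hi k hk
    obtain ⟨i, -, rfl⟩ := Finset.mem_image.1 hi
    obtain ⟨k, -, rfl⟩ := Finset.mem_image.1 hk
    rw [htk, htk, hf_smul_left, hf_smul_right, hs, hrs, sg_kap, ← hsq]
    simp only [(kap_inj hq hp).eq_iff]
    split_ifs
    · field_simp
    · simp)
  have hM : Matrix.of M * sigMatrix q' p' * (Matrix.of M)ᴴ = sigMatrix q' p' := by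
    ext i k
    rw [sig_mul]
    have : sigMatrix q' p' = Matrix.diagonal (sg q' p') := rfl
    rw [this, Matrix.diagonal_apply]
    exact hM2 i k
  refine ⟨Matrix.of M, r, hr0, ?_, hM, ?_⟩
  · have : Matrix.of M * (sigMatrix q' p' * (Matrix.of M)ᴴ * sigMatrix q' p') = 1 := by
      rw [← Matrix.mul_assoc, ← Matrix.mul_assoc, hM, sig_sq]
    exact IsUnit.of_mul_eq_one _ this
  · intro z
    have hv : (padSig q p q' p' z) ᵥ* (Matrix.of M) = ∑ l, padSig q p q' p' z l • M l := by
      ext k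
      simp [Matrix.vecMul, dotProduct]
    rw [hv, ev_deg_one H.hP, Finset.smul_sum]
    refine Fintype.sum_of_injective (kap hq hp) (kap_inj hq hp) _ _ ?_ ?_
    · intro l hl
      rw [pad_zero hq hp z l hl, zero_smul, smul_zero]
    · intro i
      rw [pad_kap, hM1 _ (Finset.mem_image_of_mem _ (Finset.mem_univ i)), htk, smul_comm (z i),
        smul_smul, mul_inv_cancel₀ hr0, one_smul]


/-- A fibral-image-preserving rational proper map from `D_{q,p}` to `D_{q',p'}`
(`p ≥ q ≥ 2`, `q ≤ q'`, `p ≤ p'`, `q' < min {2q-1, p}`) is linear: its degree is `1`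
and, up to generalized unitary matrices and a nonzero scalar, it is the standard
zero-padding map. -/
theorem stmt_16 (q p q' p' : ℕ) (h0q' : 0 < q') (h0p' : 0 < p')
    (h2q : 2 ≤ q) (hqp : q ≤ p) (hqq' : q ≤ q') (hpp' : p ≤ p')
    (hq' : q' < min (2 * q - 1) p)
    (d : ℕ) (P1 : Fin q' → MvPolynomial (Fin (q + p)) ℂ)
    (P2 : Fin p' → MvPolynomial (Fin (q + p)) ℂ)
    (hrep : IsRatProperRep q p q' p' d P1 P2)
    (hfip : ∀ Z ∈ typeIDomain q p, ∃ W ∈ typeIDomain q' p',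
      ∀ A : Fin q → ℂ,
        ¬ ((∀ i, MvPolynomial.eval (Fin.append A (A ᵥ* Z)) (P1 i) = 0) ∧
           (∀ j, MvPolynomial.eval (Fin.append A (A ᵥ* Z)) (P2 j) = 0)) →
        (fun i => MvPolynomial.eval (Fin.append A (A ᵥ* Z)) (P1 i)) ᵥ* W
          = fun j => MvPolynomial.eval (Fin.append A (A ᵥ* Z)) (P2 j)) :
    d = 1 ∧
    ∃ (Q : Matrix (Fin (q + p)) (Fin (q + p)) ℂ)
      (M : Matrix (Fin (q' + p')) (Fin (q' + p')) ℂ) (c : ℂ),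
      c ≠ 0 ∧ IsUnit Q ∧ IsUnit M ∧
      Q * sigMatrix q p * Qᴴ = sigMatrix q p ∧
      M * sigMatrix q' p' * Mᴴ = sigMatrix q' p' ∧
      ∀ z : Fin (q + p) → ℂ,
        (fun t => MvPolynomial.eval (z ᵥ* Q) (Fin.append P1 P2 t))
          = c • ((padSig q p q' p' z) ᵥ* M) := by
  have hq1 : q' < 2 * q - 1 := lt_of_lt_of_le hq' (min_le_left _ _)
  have h2p : 2 ≤ p := h2q.trans hqp
  have H := mk_dat h2q h2p hrep
  obtain ⟨O, hO⟩ := mk_fip P1 P2 hfip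
  have hd : d = 1 := degree_one H
    (fun w1 w hw s t => F2_mem H hO h2q (by omega) (by omega) hw s t) (by omega) hrep.1
    (mk_cop hrep)
  subst hd
  obtain ⟨M, c, hc, hM, hM2, hMz⟩ := final_lin h2q h2p hqq' hpp' H
  refine ⟨rfl, 1, M, c, hc, isUnit_one, hM, by simp, hM2, fun z => ?_⟩
  rw [Matrix.vecMul_one]
  exact hMz z
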